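/- arXiv:math/9807176 — 4 statements merged into one kernel-verified Lean document; each statement's English description precedes it below -/
import Mathlib

section
/- Fix 0 ≤ d ≤ n. Let F_A, F_B, F_C be finitely generated free D_n-modules with given shift vectors, let A ⊆ F_A, B ⊆ F_B, C ⊆ F_C be submodules carrying the intersection filtrations, and suppose 0 → A → B → C → 0 is an exact, V_d-strict sequence of D_n-modules. Then there exist finitely generated free D_n-modules P_A, P_C and P_B = P_A ⊕ P_C with shift vectors 𝔪_A, 𝔪_C, 𝔪_B = (𝔪_A, 𝔪_C), and surjections P_X ↠ X (X ∈ {A,B,C}) with kernels K_X carrying the intersection filtrations, forming a commutative diagram over 0 → A → B → C → 0 in which the rows 0 → P_A → P_B → P_C → 0 (canonical inclusion and projection) and 0 → K_A → K_B → K_C → 0 and the columns 0 → K_X → P_X → X → 0 are all exact and V_d-strict, i.e., exact on every filtration level F^j. -/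
set_option synthInstance.maxHeartbeats 1000000
set_option maxHeartbeats 4000000
set_option linter.unusedVariables false

open scoped TensorProduct

noncomputable section

/-- The polynomial ring `R = ℂ[x₁,…,xₙ]`. -/
abbrev Rp (n : ℕ) := MvPolynomial (Fin n) ℂ

/-- Multiplication by `xᵢ`, as a `ℂ`-linear endomorphism of `ℂ[x₁,…,xₙ]`. -/
def mulOp {n : ℕ} (i : Fin n) : Module.End ℂ (Rp n) :=
  LinearMap.mulLeft ℂ (MvPolynomial.X i)

/-- The partial derivative `∂ᵢ`, as a `ℂ`-linear endomorphism of `ℂ[x₁,…,xₙ]`. -/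
def derOp {n : ℕ} (i : Fin n) : Module.End ℂ (Rp n) :=
  (MvPolynomial.pderiv i).toLinearMap

/-- The `n`-th Weyl algebra `Dₙ`, realized concretely as the `ℂ`-subalgebra of the
`ℂ`-linear endomorphisms of `ℂ[x₁,…,xₙ]` generated by the multiplication
operators `x₁,…,xₙ` and the partial derivative operators `∂₁,…,∂ₙ`. -/
def Weyl (n : ℕ) : Subalgebra ℂ (Module.End ℂ (Rp n)) :=
  Algebra.adjoin ℂ (Set.range (mulOp (n := n)) ∪ Set.range (derOp (n := n)))

/-- The element `xᵢ` of the Weyl algebra. -/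
def wx {n : ℕ} (i : Fin n) : Weyl n :=
  ⟨mulOp i, Algebra.subset_adjoin (Or.inl ⟨i, rfl⟩)⟩

/-- The element `∂ᵢ` of the Weyl algebra. -/
def wd {n : ℕ} (i : Fin n) : Weyl n :=
  ⟨derOp i, Algebra.subset_adjoin (Or.inr ⟨i, rfl⟩)⟩

instance (priority := 10000) weylRing (n : ℕ) : Ring ↥(Weyl n) :=
  inferInstanceAs (Ring ↥(Weyl n).toSubring)

instance (priority := 10000) weylAddCommGroup (n : ℕ) : AddCommGroup ↥(Weyl n) :=
  (weylRing n).toAddCommGroup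

instance (priority := 10000) weylModC (n : ℕ) : Module ℂ ↥(Weyl n) :=
  inferInstance

instance (priority := 10000) weylAlgebra (n : ℕ) : Algebra ℂ ↥(Weyl n) :=
  inferInstance

/-- The monomial `x^α ∂^β` in the Weyl algebra. -/
def wmono {n : ℕ} (α β : Fin n → ℕ) : Weyl n :=
  (List.ofFn fun i : Fin n => (wx i) ^ (α i)).prod *
    (List.ofFn fun i : Fin n => (wd i) ^ (β i)).prod

/-- The `V_d`-filtration `F^j(Dₙ)`: the `ℂ`-span of the monomials `x^α ∂^β`
with `|β_H| ≤ |α_H| + j`, where `|γ_H| = γ₁ + … + γ_d`. -/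
def Vfil (n d : ℕ) (j : ℤ) : Submodule ℂ (Weyl n) :=
  Submodule.span ℂ { w | ∃ α β : Fin n → ℕ,
    w = wmono α β ∧
    (∑ i : Fin n, if (i : ℕ) < d then (β i : ℤ) else 0) ≤
      (∑ i : Fin n, if (i : ℕ) < d then (α i : ℤ) else 0) + j }

/-- The shifted `V_d`-filtration `F^j[𝔪](A) = Σᵢ F^{j-𝔪(i)}(Dₙ)·eᵢ` on the free
module `A = Dₙ^m` with shift vector `𝔪`, as a set. -/
def VfilFree (n d : ℕ) {m : ℕ} (𝔪 : Fin m → ℤ) (j : ℤ) : Set (Fin m → Weyl n) :=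
  { v | ∀ i, v i ∈ Vfil n d (j - 𝔪 i) }

/-- the intersection (`V_d`-)filtration on a submodule `N` of a free module,
`F^j[𝔪](N) = F^j[𝔪](A) ∩ N`, as a set of elements of `N`. -/
def VfilSub (n d : ℕ) {m : ℕ} (𝔪 : Fin m → ℤ) (N : Submodule (Weyl n) (Fin m → Weyl n))
    (j : ℤ) : Set N :=
  { x | ∀ i, (x : Fin m → Weyl n) i ∈ Vfil n d (j - 𝔪 i) }

theorem mul_prod_ofFn_pow {M : Type*} [Monoid M] {n : ℕ} (f : Fin n → M)
    (hf : ∀ i j, Commute (f i) (f j)) (a : Fin n → ℕ) (k : Fin n) :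
    f k * (List.ofFn fun i => f i ^ a i).prod =
      (List.ofFn fun i => f i ^ (a i + Finsupp.single k 1 i)).prod := by
  induction n with
  | zero => exact k.elim0
  | succ n ih =>
    simp only [List.ofFn_succ, List.prod_cons]
    refine Fin.cases ?_ (fun k => ?_) k
    · simp [← mul_assoc, pow_succ', Fin.succ_ne_zero]
    · rw [← mul_assoc, ((hf k.succ 0).pow_right _).eq, mul_assoc,
        ih (fun i => f i.succ) (fun i j => hf _ _)]
      simp [Finsupp.single_apply]

theorem wx_commute {n : ℕ} (i j : Fin n) : Commute (wx i) (wx j) := by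
  apply Subtype.ext
  refine LinearMap.ext fun p => ?_
  change MvPolynomial.X i * (MvPolynomial.X j * p) = MvPolynomial.X j * (MvPolynomial.X i * p)
  ring

theorem pderiv_comm {n : ℕ} (i j : Fin n) (p : Rp n) :
    MvPolynomial.pderiv i (MvPolynomial.pderiv j p) =
      MvPolynomial.pderiv j (MvPolynomial.pderiv i p) := by
  have h : ⁅(MvPolynomial.pderiv i : Derivation ℂ (Rp n) (Rp n)),
      (MvPolynomial.pderiv j : Derivation ℂ (Rp n) (Rp n))⁆ = 0 := by
    refine MvPolynomial.derivation_ext fun k => ?_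
    simp [Derivation.commutator_apply, MvPolynomial.pderiv_X, Pi.single_apply, apply_ite]
  have := congrArg (fun D => D p) h
  simpa [Derivation.commutator_apply, sub_eq_zero] using this

theorem wd_commute {n : ℕ} (i j : Fin n) : Commute (wd i) (wd j) :=
  Subtype.ext <| LinearMap.ext fun p => pderiv_comm i j p

theorem coe_prod_wx_pow {n : ℕ} (s : Fin n →₀ ℕ) :
    (((List.ofFn fun i : Fin n => wx i ^ s i).prod : Weyl n) : Module.End ℂ (Rp n)) =
      LinearMap.mulLeft ℂ (MvPolynomial.monomial s 1) := by
  have h := map_list_prod (Algebra.lmul ℂ (Rp n))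
    (List.ofFn fun i : Fin n => (MvPolynomial.X i : Rp n) ^ s i)
  rw [List.prod_ofFn] at h
  rw [MvPolynomial.monomial_eq, Finsupp.prod_fintype _ _ (by simp), MvPolynomial.C_1, one_mul]
  refine Eq.trans ?_ h.symm
  refine (map_list_prod (Weyl n).val _).trans ?_
  simp only [List.map_ofFn]
  congr 1
  refine congrArg List.ofFn (funext fun i => ?_)
  exact (map_pow (Weyl n).val (wx i) (s i)).trans
    (map_pow (Algebra.lmul ℂ (Rp n)) (MvPolynomial.X i) (s i)).symm

theorem wd_mul_prod_wx_pow {n : ℕ} (k : Fin n) (s : Fin n →₀ ℕ) :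
    wd k * (List.ofFn fun i : Fin n => wx i ^ s i).prod =
      (List.ofFn fun i : Fin n => wx i ^ s i).prod * wd k +
        (s k : ℂ) • (List.ofFn fun i : Fin n => wx i ^ (s - Finsupp.single k 1 : Fin n →₀ ℕ) i).prod := by
  apply Subtype.ext
  refine LinearMap.ext fun p => ?_
  have h1 := coe_prod_wx_pow s
  have h2 := coe_prod_wx_pow (s - Finsupp.single k 1)
  change MvPolynomial.pderiv k ((List.ofFn fun i : Fin n => wx i ^ s i).prod.1 p) =
    (List.ofFn fun i : Fin n => wx i ^ s i).prod.1 (MvPolynomial.pderiv k p) +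
    (s k : ℂ) • (List.ofFn fun i : Fin n => wx i ^ (s - Finsupp.single k 1 : Fin n →₀ ℕ) i).prod.1 p
  rw [h1, h2]
  simp only [LinearMap.mulLeft_apply, Derivation.leibniz, MvPolynomial.pderiv_monomial,
    smul_eq_mul, one_mul]
  rw [mul_comm p, ← smul_mul_assoc, MvPolynomial.smul_monomial, smul_eq_mul, mul_one]

/-- Exponents `(α, β)` of the monomials `x^α ∂^β`. -/
abbrev WExp (n : ℕ) := (Fin n ⊕ Fin n) →₀ ℕ

/-- The monomial `x^α ∂^β` with exponent `(α, β)`. -/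
def wmon {n : ℕ} (c : WExp n) : Weyl n :=
  wmono (fun i => c (Sum.inl i)) (fun i => c (Sum.inr i))

/-- The `V_d`-weight `|β_H| - |α_H|` of the exponent `(α, β)`. -/
def vweight (n d : ℕ) : WExp n →+ ℤ where
  toFun c := ∑ i : Fin n, if (i : ℕ) < d then (c (Sum.inr i) : ℤ) - c (Sum.inl i) else 0
  map_zero' := by simp
  map_add' a b := by
    rw [← Finset.sum_add_distrib]
    refine Finset.sum_congr rfl fun i _ => ?_
    split_ifs
    · simp only [Finsupp.add_apply]
      push_cast
      ring
    · simp

theorem vweight_apply (n d : ℕ) (c : WExp n) : vweight n d c =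
    ∑ i : Fin n, if (i : ℕ) < d then (c (Sum.inr i) : ℤ) - c (Sum.inl i) else 0 :=
  rfl

theorem Vfil_eq_span (n d : ℕ) (j : ℤ) :
    Vfil n d j = Submodule.span ℂ (wmon '' {c : WExp n | vweight n d c ≤ j}) := by
  have key : ∀ α β : Fin n → ℕ,
      ((∑ i : Fin n, if (i : ℕ) < d then (β i : ℤ) else 0) ≤
        (∑ i : Fin n, if (i : ℕ) < d then (α i : ℤ) else 0) + j) ↔
      (∑ i : Fin n, if (i : ℕ) < d then (β i : ℤ) - α i else 0) ≤ j := by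
    intro α β
    have : (∑ i : Fin n, if (i : ℕ) < d then (β i : ℤ) - α i else 0) =
        (∑ i : Fin n, if (i : ℕ) < d then (β i : ℤ) else 0) -
          ∑ i : Fin n, if (i : ℕ) < d then (α i : ℤ) else 0 := by
      rw [← Finset.sum_sub_distrib]
      refine Finset.sum_congr rfl fun i _ => ?_
      split_ifs <;> simp
    rw [this]
    constructor <;> intro h <;> linarith
  unfold Vfil
  congr 1
  ext w
  constructor
  · rintro ⟨α, β, rfl, h⟩
    exact ⟨Finsupp.equivFunOnFinite.symm (Sum.elim α β), (key α β).1 h, rfl⟩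
  · rintro ⟨c, h, rfl⟩
    exact ⟨_, _, rfl, (key _ _).2 h⟩

theorem wmon_zero (n : ℕ) : wmon (0 : WExp n) = 1 := by
  simp [wmon, wmono]

theorem wx_mul_wmon {n : ℕ} (k : Fin n) (c : WExp n) :
    wx k * wmon c = wmon (c + Finsupp.single (Sum.inl k) 1) := by
  unfold wmon wmono
  rw [← mul_assoc, mul_prod_ofFn_pow _ wx_commute]
  simp [Finsupp.single_apply]

theorem wd_mul_wmon {n : ℕ} (k : Fin n) (c : WExp n) :
    wd k * wmon c = wmon (c + Finsupp.single (Sum.inr k) 1) +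
      (c (Sum.inl k) : ℂ) • wmon (c - Finsupp.single (Sum.inl k) 1) := by
  have h := wd_mul_prod_wx_pow k
    (Finsupp.equivFunOnFinite.symm fun i => c (Sum.inl i))
  simp only [Finsupp.equivFunOnFinite_symm_apply_apply] at h
  unfold wmon wmono
  rw [← mul_assoc, h, add_mul, mul_assoc, mul_prod_ofFn_pow _ wd_commute]
  simp [Finsupp.single_apply]

/-- A monomial order on finitely many variables. -/
def finiteMonomialOrder (σ : Type) [Finite σ] : MonomialOrder σ :=
  letI : LinearOrder σ := LinearOrder.lift' (Finite.equivFin σ) (Equiv.injective _)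
  MonomialOrder.lex

/-- A monomial order on the exponents of the monomials `x^α ∂^β`. -/
def wOrder (n : ℕ) : MonomialOrder (Fin n ⊕ Fin n) :=
  finiteMonomialOrder _

/-- The position of the monomial `x^α ∂^β eᵢ` in the term-over-position order. -/
def wKey {n m : ℕ} (p : WExp n × Fin m) : (wOrder n).syn ×ₗ Fin m :=
  toLex ((wOrder n).toSyn p.1, p.2)

theorem wKey_injective {n m : ℕ} : Function.Injective (wKey (n := n) (m := m)) := by
  rintro ⟨a, i⟩ ⟨b, k⟩ h
  have h' := congrArg ofLex h
  simpa [wKey] using h'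

theorem wKey_add_lt {n m : ℕ} {p q : WExp n × Fin m} (a : WExp n) (h : wKey p < wKey q) :
    wKey (p.1 + a, p.2) < wKey (q.1 + a, q.2) := by
  simpa [wKey, Prod.Lex.toLex_lt_toLex] using h

theorem wKey_lt_of_lt {n m : ℕ} {a b : WExp n} (i : Fin m) (h : a < b) :
    wKey (a, i) < wKey (b, i) := by
  simpa [wKey, Prod.Lex.toLex_lt_toLex] using (wOrder n).toSyn_strictMono h

/-- The monomial `x^α ∂^β eᵢ` of the free module. -/
def freeMon {n m : ℕ} (p : WExp n × Fin m) : Fin m → Weyl n :=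
  Pi.single p.2 (wmon p.1)

/-- The shifted `V_d`-weight of the monomial `x^α ∂^β eᵢ`. -/
def freeWeight (n d : ℕ) {m : ℕ} (𝔪 : Fin m → ℤ) (p : WExp n × Fin m) : ℤ :=
  vweight n d p.1 + 𝔪 p.2

/-- The span of the monomials of shifted weight at most `j`. -/
def weightSpan (n d : ℕ) {m : ℕ} (𝔪 : Fin m → ℤ) (j : ℤ) : Submodule ℂ (Fin m → Weyl n) :=
  Submodule.span ℂ (freeMon '' {p | freeWeight n d 𝔪 p ≤ j})

/-- The span of the monomials of shifted weight at most `j` which are smaller than `p`. -/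
def lowerSpan (n d : ℕ) {m : ℕ} (𝔪 : Fin m → ℤ) (j : ℤ) (p : WExp n × Fin m) :
    Submodule ℂ (Fin m → Weyl n) :=
  Submodule.span ℂ (freeMon '' {q | freeWeight n d 𝔪 q ≤ j ∧ wKey q < wKey p})

theorem lowerSpan_le_weightSpan (n d : ℕ) {m : ℕ} (𝔪 : Fin m → ℤ) (j : ℤ)
    (p : WExp n × Fin m) : lowerSpan n d 𝔪 j p ≤ weightSpan n d 𝔪 j :=
  Submodule.span_mono (Set.image_mono fun _ h => h.1)

theorem lowerSpan_mono {n d m : ℕ} {𝔪 : Fin m → ℤ} {j k : ℤ} {p q : WExp n × Fin m}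
    (hjk : j ≤ k) (hpq : wKey p ≤ wKey q) : lowerSpan n d 𝔪 j p ≤ lowerSpan n d 𝔪 k q :=
  Submodule.span_mono (Set.image_mono fun _ h => ⟨h.1.trans hjk, h.2.trans_le hpq⟩)

theorem mem_weightSpan_iff {n d m : ℕ} {𝔪 : Fin m → ℤ} {j : ℤ} {v : Fin m → Weyl n} :
    v ∈ weightSpan n d 𝔪 j ↔ ∀ i, v i ∈ Vfil n d (j - 𝔪 i) := by
  constructor
  · intro hv i
    refine Submodule.span_le (p := (Vfil n d (j - 𝔪 i)).comap
      (LinearMap.proj (R := ℂ) (φ := fun _ : Fin m => Weyl n) i)) |>.2 ?_ hv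
    rintro _ ⟨p, hp, rfl⟩
    change freeMon p i ∈ Vfil n d (j - 𝔪 i)
    by_cases hi : i = p.2
    · subst hi
      rw [freeMon, Pi.single_eq_same, Vfil_eq_span]
      exact Submodule.subset_span ⟨p.1, (le_sub_iff_add_le.2 hp : vweight n d p.1 ≤ j - 𝔪 p.2), rfl⟩
    · rw [freeMon, Pi.single_eq_of_ne hi]
      exact zero_mem _
  · intro hv
    rw [← Finset.univ_sum_single v]
    refine sum_mem fun i _ => ?_
    have h := hv i
    rw [Vfil_eq_span] at h
    refine Submodule.span_le (p := (weightSpan n d 𝔪 j).comap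
      (LinearMap.single ℂ (fun _ : Fin m => Weyl n) i)) |>.2 ?_ h
    rintro _ ⟨c, hc, rfl⟩
    exact Submodule.subset_span ⟨(c, i), (le_sub_iff_add_le.1 hc : vweight n d c + 𝔪 i ≤ j), rfl⟩

/-- The operator `Q` acts on monomials as the shift of exponents by `a`, up to smaller terms. -/
def ActsAsShift (n d : ℕ) {m : ℕ} (𝔪 : Fin m → ℤ) (a : WExp n) (Q : Weyl n) : Prop :=
  ∀ p : WExp n × Fin m, Q • freeMon p - freeMon (p.1 + a, p.2) ∈
    lowerSpan n d 𝔪 (freeWeight n d 𝔪 p + vweight n d a) (p.1 + a, p.2)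

theorem freeWeight_add (n d : ℕ) {m : ℕ} (𝔪 : Fin m → ℤ) (p : WExp n × Fin m) (a : WExp n) :
    freeWeight n d 𝔪 (p.1 + a, p.2) = freeWeight n d 𝔪 p + vweight n d a := by
  simp only [freeWeight, map_add]
  ring

namespace ActsAsShift

variable {n d m : ℕ} {𝔪 : Fin m → ℤ} {a b : WExp n} {P Q : Weyl n}

theorem smul_mem_lowerSpan (hQ : ActsAsShift n d 𝔪 a Q) {j : ℤ} {p : WExp n × Fin m}
    {v : Fin m → Weyl n} (hv : v ∈ lowerSpan n d 𝔪 j p) :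
    Q • v ∈ lowerSpan n d 𝔪 (j + vweight n d a) (p.1 + a, p.2) := by
  induction hv using Submodule.span_induction with
  | zero => rw [smul_zero]; exact zero_mem _
  | add x y _ _ hx hy => rw [smul_add]; exact add_mem hx hy
  | smul r x _ hx => rw [smul_comm]; exact Submodule.smul_mem _ r hx
  | mem x hx =>
    obtain ⟨q, ⟨hqj, hqp⟩, rfl⟩ := hx
    have hlt := wKey_add_lt a hqp
    rw [← sub_add_cancel (Q • freeMon q) (freeMon (q.1 + a, q.2))]
    refine add_mem (lowerSpan_mono (by gcongr) hlt.le (hQ q)) ?_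
    exact Submodule.subset_span ⟨_, ⟨by rw [freeWeight_add]; gcongr, hlt⟩, rfl⟩

theorem smul_mem_weightSpan (hQ : ActsAsShift n d 𝔪 a Q) {j : ℤ}
    {v : Fin m → Weyl n} (hv : v ∈ weightSpan n d 𝔪 j) :
    Q • v ∈ weightSpan n d 𝔪 (j + vweight n d a) := by
  induction hv using Submodule.span_induction with
  | zero => rw [smul_zero]; exact zero_mem _
  | add x y _ _ hx hy => rw [smul_add]; exact add_mem hx hy
  | smul r x _ hx => rw [smul_comm]; exact Submodule.smul_mem _ r hx
  | mem x hx =>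
    obtain ⟨q, hqj, rfl⟩ := hx
    rw [← sub_add_cancel (Q • freeMon q) (freeMon (q.1 + a, q.2))]
    refine add_mem (lowerSpan_le_weightSpan n d 𝔪 _ _
      (lowerSpan_mono (add_le_add_left hqj _) le_rfl (hQ q))) ?_
    exact Submodule.subset_span ⟨_, (freeWeight_add n d 𝔪 q a).trans_le
      (add_le_add_left hqj _), rfl⟩

theorem one : ActsAsShift n d 𝔪 0 (1 : Weyl n) := by
  intro p
  rw [one_smul, add_zero, sub_self]
  exact zero_mem _

theorem mul (hP : ActsAsShift n d 𝔪 a P) (hQ : ActsAsShift n d 𝔪 b Q) :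
    ActsAsShift n d 𝔪 (a + b) (P * Q) := by
  intro p
  have h1 := hP.smul_mem_lowerSpan (hQ p)
  have h2 := hP (p.1 + b, p.2)
  rw [freeWeight_add] at h2
  have h := add_mem h1 h2
  rwa [smul_sub, ← mul_smul, sub_add_sub_cancel, add_assoc, add_assoc, ← map_add,
    add_comm b a] at h

theorem pow (hQ : ActsAsShift n d 𝔪 a Q) (k : ℕ) : ActsAsShift n d 𝔪 (k • a) (Q ^ k) := by
  induction k with
  | zero => rw [zero_smul, pow_zero]; exact one
  | succ k ih => rw [succ_nsmul, pow_succ]; exact ih.mul hQ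

theorem prod_ofFn {l : ℕ} (e : Fin l → WExp n) (R : Fin l → Weyl n)
    (h : ∀ i, ActsAsShift n d 𝔪 (e i) (R i)) :
    ActsAsShift n d 𝔪 (∑ i, e i) (List.ofFn R).prod := by
  induction l with
  | zero => simpa using one
  | succ l ih =>
    rw [Fin.sum_univ_succ, List.ofFn_succ, List.prod_cons]
    exact (h 0).mul (ih _ _ fun i => h i.succ)

theorem wx (k : Fin n) : ActsAsShift n d 𝔪 (Finsupp.single (Sum.inl k) 1) (wx k) := by
  intro p
  have : _root_.wx k • freeMon p = freeMon (p.1 + Finsupp.single (Sum.inl k) 1, p.2) := by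
    rw [freeMon, freeMon, ← Pi.single_smul, smul_eq_mul, wx_mul_wmon]
  rw [this, sub_self]
  exact zero_mem _

theorem wd (k : Fin n) : ActsAsShift n d 𝔪 (Finsupp.single (Sum.inr k) 1) (wd k) := by
  intro p
  have h : _root_.wd k • freeMon p = freeMon (p.1 + Finsupp.single (Sum.inr k) 1, p.2) +
      (p.1 (Sum.inl k) : ℂ) • freeMon (p.1 - Finsupp.single (Sum.inl k) 1, p.2) := by
    rw [freeMon, freeMon, freeMon, ← Pi.single_smul, smul_eq_mul, wd_mul_wmon, Pi.single_add,
      Pi.single_smul]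
  rw [h, add_sub_cancel_left]
  by_cases h0 : p.1 (Sum.inl k) = 0
  · rw [h0, Nat.cast_zero, zero_smul]
    exact zero_mem _
  obtain ⟨c, hc⟩ : ∃ c, p.1 = c + Finsupp.single (Sum.inl k) 1 :=
    ⟨p.1 - Finsupp.single (Sum.inl k) 1,
      (tsub_add_cancel_of_le (by simpa using Nat.one_le_iff_ne_zero.2 h0)).symm⟩
  refine Submodule.smul_mem _ _ (Submodule.subset_span ⟨_, ⟨?_, ?_⟩, rfl⟩)
  · have hw : vweight n d (Finsupp.single (Sum.inl k) 1) +
        vweight n d (Finsupp.single (Sum.inr k) 1) = 0 := by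
      rw [← map_add (vweight n d)]
      rw [vweight_apply]
      refine Finset.sum_eq_zero fun i _ => ?_
      simp [Finsupp.single_apply]
    simp only [freeWeight, hc, add_tsub_cancel_right, map_add]
    linarith
  · refine wKey_lt_of_lt p.2 (lt_of_le_of_lt tsub_le_self (lt_add_of_pos_right _ ?_))
    exact pos_iff_ne_zero.2 (by simp)

theorem wmon (a : WExp n) : ActsAsShift n d 𝔪 a (wmon a) := by
  have ha : a = (∑ i, a (Sum.inl i) • Finsupp.single (Sum.inl i) 1) +
      ∑ i, a (Sum.inr i) • Finsupp.single (Sum.inr i) 1 := by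
    ext i
    rcases i with i | i <;> simp [Finsupp.single_apply]
  have := (prod_ofFn _ _ fun i => (wx (d := d) (𝔪 := 𝔪) i).pow (a (Sum.inl i))).mul
    (prod_ofFn _ _ fun i => (wd (d := d) (𝔪 := 𝔪) i).pow (a (Sum.inr i)))
  rwa [← ha] at this

end ActsAsShift

theorem smul_mem_weightSpan {n d m : ℕ} {𝔪 : Fin m → ℤ} {j k : ℤ} {Q : Weyl n}
    {v : Fin m → Weyl n} (hQ : Q ∈ Vfil n d j) (hv : v ∈ weightSpan n d 𝔪 k) :
    Q • v ∈ weightSpan n d 𝔪 (j + k) := by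
  rw [Vfil_eq_span] at hQ
  induction hQ using Submodule.span_induction with
  | zero => rw [zero_smul]; exact zero_mem _
  | add x y _ _ hx hy => rw [add_smul]; exact add_mem hx hy
  | smul r x _ hx => rw [smul_assoc]; exact Submodule.smul_mem _ r hx
  | mem x hx =>
    obtain ⟨c, hc, rfl⟩ := hx
    refine Submodule.span_mono (Set.image_mono fun p hp => ?_)
      ((ActsAsShift.wmon c).smul_mem_weightSpan hv)
    have hc' : vweight n d c ≤ j := hc
    have hp' : freeWeight n d 𝔪 p ≤ k + vweight n d c := hp
    change freeWeight n d 𝔪 p ≤ j + k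
    linarith

theorem Vfil_mono {n d : ℕ} {j k : ℤ} (h : j ≤ k) : Vfil n d j ≤ Vfil n d k := by
  rw [Vfil_eq_span, Vfil_eq_span]
  exact Submodule.span_mono (Set.image_mono fun _ hc => le_trans hc h)

theorem mul_mem_Vfil {n d : ℕ} {j k : ℤ} {P Q : Weyl n} (hP : P ∈ Vfil n d j)
    (hQ : Q ∈ Vfil n d k) : P * Q ∈ Vfil n d (j + k) := by
  have h : (fun _ : Fin 1 => Q) ∈ weightSpan n d (fun _ : Fin 1 => 0) k :=
    mem_weightSpan_iff.2 fun _ => by simpa using hQ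
  simpa using mem_weightSpan_iff.1 (smul_mem_weightSpan hP h) 0

theorem wmon_mem_Vfil {n d : ℕ} (c : WExp n) : wmon c ∈ Vfil n d (vweight n d c) := by
  rw [Vfil_eq_span]
  exact Submodule.subset_span ⟨c, le_refl (vweight n d c), rfl⟩

theorem wx_mem_Vfil {n d : ℕ} (i : Fin n) :
    wx i ∈ Vfil n d (vweight n d (Finsupp.single (Sum.inl i) 1)) := by
  have h := wx_mul_wmon i 0
  rw [wmon_zero, mul_one, zero_add] at h
  rw [h]
  exact wmon_mem_Vfil _

theorem wd_mem_Vfil {n d : ℕ} (i : Fin n) :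
    wd i ∈ Vfil n d (vweight n d (Finsupp.single (Sum.inr i) 1)) := by
  have h := wd_mul_wmon i 0
  rw [wmon_zero, mul_one, zero_add, Finsupp.zero_apply, Nat.cast_zero, zero_smul,
    add_zero] at h
  rw [h]
  exact wmon_mem_Vfil _

theorem algebraMap_mem_Vfil {n d : ℕ} (r : ℂ) : algebraMap ℂ (Weyl n) r ∈ Vfil n d 0 := by
  have h := Submodule.smul_mem _ r (wmon_mem_Vfil (d := d) (0 : WExp n))
  rwa [wmon_zero, map_zero, ← Algebra.algebraMap_eq_smul_one] at h

theorem exists_mem_Vfil {n : ℕ} (d : ℕ) (Q : Weyl n) : ∃ j, Q ∈ Vfil n d j := by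
  have hadd : ∀ P Q : Weyl n, (∃ j, P ∈ Vfil n d j) → (∃ j, Q ∈ Vfil n d j) →
      ∃ j, P + Q ∈ Vfil n d j := fun P Q ⟨j, hj⟩ ⟨k, hk⟩ =>
    ⟨max j k, add_mem (Vfil_mono (le_max_left j k) hj) (Vfil_mono (le_max_right j k) hk)⟩
  have hmul : ∀ P Q : Weyl n, (∃ j, P ∈ Vfil n d j) → (∃ j, Q ∈ Vfil n d j) →
      ∃ j, P * Q ∈ Vfil n d j := fun P Q ⟨j, hj⟩ ⟨k, hk⟩ => ⟨j + k, mul_mem_Vfil hj hk⟩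
  obtain ⟨Q, hQ⟩ := Q
  refine Algebra.adjoin_induction (p := fun x hx => ∃ j, (⟨x, hx⟩ : Weyl n) ∈ Vfil n d j)
    ?_ ?_ (fun x y hx hy => hadd ⟨x, hx⟩ ⟨y, hy⟩) (fun x y hx hy => hmul ⟨x, hx⟩ ⟨y, hy⟩) hQ
  · rintro x (⟨i, rfl⟩ | ⟨i, rfl⟩)
    · exact ⟨_, wx_mem_Vfil i⟩
    · exact ⟨_, wd_mem_Vfil i⟩
  · exact fun r => ⟨0, algebraMap_mem_Vfil r⟩

theorem exists_finite_dominating {ι α : Type*} [Finite ι] [PartialOrder α]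
    [WellQuasiOrderedLE α] (S : Set (α × ι)) :
    ∃ G ⊆ S, G.Finite ∧ ∀ x ∈ S, ∃ g ∈ G, g.1 ≤ x.1 ∧ g.2 = x.2 := by
  refine ⟨{g | Minimal (fun c => (c, g.2) ∈ S) g.1}, fun g hg => Minimal.prop (P := fun c => (c, g.2) ∈ S) hg, ?_, fun x hx => ?_⟩
  · have hfin (i : ι) : {c : α | Minimal (fun c => (c, i) ∈ S) c}.Finite :=
      WellQuasiOrderedLE.finite_of_isAntichain (setOfPred_minimal_antichain _)
    refine (Set.finite_iUnion fun i => (hfin i).image fun c => (c, i)).subset fun g hg => ?_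
    exact Set.mem_iUnion.2 ⟨g.2, g.1, hg, rfl⟩
  · obtain ⟨c, hc, hmin⟩ := exists_minimal_le_of_wellFoundedLT (fun c => (c, x.2) ∈ S) x.1 hx
    exact ⟨(c, x.2), hmin, hc, rfl⟩

theorem exists_leading_term {ι V K : Type*} [AddCommGroup V] [Module ℂ V] [LinearOrder K]
    (b : ι → V) (κ : ι → K) (hκ : Function.Injective κ) {X : Set ι} {v : V}
    (hv : v ∈ Submodule.span ℂ (b '' X)) (hv0 : v ≠ 0) :
    ∃ x ∈ X, ∃ r : ℂ, r ≠ 0 ∧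
      v - r • b x ∈ Submodule.span ℂ (b '' {y | y ∈ X ∧ κ y < κ x}) := by
  classical
  obtain ⟨l, hl, rfl⟩ := (Finsupp.mem_span_image_iff_linearCombination ℂ).1 hv
  have hne : l.support.Nonempty := by
    rw [Finsupp.support_nonempty_iff]
    rintro rfl
    exact hv0 (map_zero _)
  obtain ⟨x, hx, hmax⟩ := l.support.exists_max_image κ hne
  refine ⟨x, hl hx, l x, Finsupp.mem_support_iff.1 hx, ?_⟩
  rw [Finsupp.linearCombination_apply, Finsupp.sum, ← Finset.add_sum_erase _ _ hx,
    add_sub_cancel_left]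
  refine sum_mem fun y hy => Submodule.smul_mem _ _ (Submodule.subset_span ⟨y, ⟨?_, ?_⟩, rfl⟩)
  · exact hl (Finset.mem_of_mem_erase hy)
  · exact (hmax y (Finset.mem_of_mem_erase hy)).lt_of_ne
      fun h => Finset.ne_of_mem_erase hy (hκ h)

theorem exists_finite_strict_generators (n d : ℕ) {m : ℕ} (𝔪 : Fin m → ℤ)
    (N : Submodule (Weyl n) (Fin m → Weyl n)) :
    ∃ (p : ℕ) (s : Fin p → ℤ) (g : Fin p → N), (∀ k, g k ∈ VfilSub n d 𝔪 N (s k)) ∧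
      ∀ j, ∀ x ∈ VfilSub n d 𝔪 N j, ∃ u ∈ VfilFree n d s j, ∑ k, u k • g k = x := by
  classical
  let S : Set ((WExp n × ℕ) × Fin m) := {e | ∃ v ∈ N, v - freeMon (e.1.1, e.2) ∈
    lowerSpan n d 𝔪 (freeWeight n d 𝔪 (e.1.1, e.2) + e.1.2) (e.1.1, e.2)}
  obtain ⟨G, hGS, hGfin, hG⟩ := exists_finite_dominating S
  have := hGfin.fintype
  choose f hfN hf using fun k : G => hGS k.2
  let w (k : G) : ℤ := freeWeight n d 𝔪 (k.1.1.1, k.1.2) + k.1.1.2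
  have hfw (k : G) : f k ∈ weightSpan n d 𝔪 (w k) := by
    rw [← sub_add_cancel (f k) (freeMon (k.1.1.1, k.1.2))]
    refine add_mem (lowerSpan_le_weightSpan n d 𝔪 _ _ (hf k)) (Submodule.subset_span ⟨_, ?_, rfl⟩)
    exact le_add_of_nonneg_right (Int.natCast_nonneg _)
  have main (j : ℤ) : ∀ (κ : (wOrder n).syn ×ₗ Fin m) (q : WExp n × Fin m), wKey q = κ →
      freeWeight n d 𝔪 q ≤ j → ∀ r : ℂ, r ≠ 0 → ∀ v ∈ N,
      v - r • freeMon q ∈ lowerSpan n d 𝔪 j q →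
      ∃ u : G → Weyl n, (∀ k, u k ∈ Vfil n d (j - w k)) ∧ ∑ k, u k • f k = v := by
    intro κ
    induction κ using WellFoundedLT.induction with
    | ind κ ih =>
    rintro q rfl hqj r hr v hv hvq
    have hS : ((q.1, (j - freeWeight n d 𝔪 q).toNat), q.2) ∈ S := by
      refine ⟨algebraMap ℂ (Weyl n) r⁻¹ • v, N.smul_mem _ hv, ?_⟩
      have h := Submodule.smul_mem _ r⁻¹ hvq
      rw [smul_sub, inv_smul_smul₀ hr] at h
      rw [algebraMap_smul]
      convert h using 2
      simp [hqj]
    obtain ⟨e, he, hle, hi⟩ := hG _ hS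
    let k : G := ⟨e, he⟩
    obtain ⟨a, ha⟩ : ∃ a, q.1 = e.1.1 + a := exists_add_of_le hle.1
    have hq : (e.1.1 + a, e.2) = q := Prod.ext ha.symm hi
    have hweight : freeWeight n d 𝔪 q = freeWeight n d 𝔪 (e.1.1, e.2) + vweight n d a := by
      rw [← hq, ← freeWeight_add]
    have hwk : w k + vweight n d a ≤ j := by
      have h1 : (e.1.2 : ℤ) ≤ j - freeWeight n d 𝔪 q := by
        have := hle.2
        simp only at this
        omega
      change freeWeight n d 𝔪 (e.1.1, e.2) + e.1.2 + vweight n d a ≤ j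
      linarith
    have hshift : wmon a • f k - freeMon q ∈ lowerSpan n d 𝔪 j q := by
      have h1 := (ActsAsShift.wmon a).smul_mem_lowerSpan (hf k)
      have h2 := ActsAsShift.wmon (d := d) (𝔪 := 𝔪) a (e.1.1, e.2)
      rw [smul_sub] at h1
      rw [hq] at h2
      have h2' : wmon a • freeMon (e.1.1, e.2) - freeMon q ∈ lowerSpan n d 𝔪 j q :=
        lowerSpan_mono (hweight.symm.trans_le hqj) le_rfl h2
      have h1' := lowerSpan_mono (q := q) hwk (congrArg wKey hq).le h1
      have h := add_mem h1' h2'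
      rwa [sub_add_sub_cancel] at h
    let Q : Weyl n := algebraMap ℂ (Weyl n) r * wmon a
    have hQ : Q ∈ Vfil n d (j - w k) := by
      refine Vfil_mono ?_ (mul_mem_Vfil (algebraMap_mem_Vfil r) (wmon_mem_Vfil a))
      linarith
    have hrest : v - Q • f k ∈ lowerSpan n d 𝔪 j q := by
      have h := sub_mem hvq (Submodule.smul_mem _ r hshift)
      rwa [smul_sub, sub_sub_sub_cancel_right, ← algebraMap_smul (Weyl n) r (wmon a • f k),
        ← mul_smul] at h
    obtain ⟨u, hu, huv⟩ : ∃ u : G → Weyl n, (∀ k, u k ∈ Vfil n d (j - w k)) ∧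
        ∑ k, u k • f k = v - Q • f k := by
      by_cases h0 : v - Q • f k = 0
      · exact ⟨0, fun _ => zero_mem _, by simp [h0]⟩
      · obtain ⟨q', ⟨hq'j, hq'⟩, r', hr', h'⟩ :=
          exists_leading_term freeMon wKey wKey_injective hrest h0
        refine ih (wKey q') hq' q' rfl hq'j r' hr' _ (N.sub_mem hv (N.smul_mem _ (hfN k))) ?_
        refine Submodule.span_mono (Set.image_mono fun y hy => ?_) h'
        exact ⟨hy.1.1, hy.2⟩
    refine ⟨u + Pi.single k Q, fun l => ?_, ?_⟩
    · refine add_mem (hu l) ?_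
      by_cases hl : l = k
      · subst hl
        rwa [Pi.single_eq_same]
      · rw [Pi.single_eq_of_ne hl]
        exact zero_mem _
    · simp only [Pi.add_apply, add_smul, Finset.sum_add_distrib, huv]
      rw [Finset.sum_eq_single k (fun l _ hl => by rw [Pi.single_eq_of_ne hl, zero_smul])
        (by simp), Pi.single_eq_same, sub_add_cancel]
  let E := (Fintype.equivFin G).symm
  refine ⟨Fintype.card G, fun i => w (E i), fun i => ⟨f (E i), hfN (E i)⟩,
    fun i => mem_weightSpan_iff.1 (hfw (E i)), fun j x hx => ?_⟩
  obtain ⟨u, hu, hux⟩ : ∃ u : G → Weyl n, (∀ k, u k ∈ Vfil n d (j - w k)) ∧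
      ∑ k, u k • f k = x := by
    by_cases h0 : (x : Fin m → Weyl n) = 0
    · exact ⟨0, fun _ => zero_mem _, by simp [h0]⟩
    · obtain ⟨q, hqj, r, hr, h⟩ := exists_leading_term freeMon wKey wKey_injective
        (mem_weightSpan_iff.2 hx) h0
      exact main j (wKey q) q rfl hqj r hr x x.2 h
  refine ⟨fun i => u (E i), fun i => hu (E i), Subtype.ext ?_⟩
  rw [← hux, ← E.sum_comp]
  simp

theorem sum_smul_mem_VfilSub {n d m p : ℕ} {𝔪 : Fin m → ℤ}
    {N : Submodule (Weyl n) (Fin m → Weyl n)} {s : Fin p → ℤ} {g : Fin p → N}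
    (hg : ∀ k, g k ∈ VfilSub n d 𝔪 N (s k)) {j : ℤ} {u : Fin p → Weyl n}
    (hu : u ∈ VfilFree n d s j) : ∑ k, u k • g k ∈ VfilSub n d 𝔪 N j := by
  refine mem_weightSpan_iff.1 ?_
  rw [AddSubmonoidClass.coe_finsetSum]
  refine sum_mem fun k _ => ?_
  have h := smul_mem_weightSpan (hu k) (mem_weightSpan_iff.2 (hg k))
  rwa [sub_add_cancel] at h

theorem exists_mem_VfilSub {n m : ℕ} (d : ℕ) (𝔪 : Fin m → ℤ)
    {N : Submodule (Weyl n) (Fin m → Weyl n)} (x : N) : ∃ j, x ∈ VfilSub n d 𝔪 N j := by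
  choose e he using fun i => exists_mem_Vfil d ((x : Fin m → Weyl n) i)
  obtain ⟨M, hM⟩ := (Set.finite_range fun i => e i + 𝔪 i).bddAbove
  exact ⟨M, fun i => Vfil_mono (le_sub_iff_add_le.2 (hM ⟨i, rfl⟩)) (he i)⟩

/-- **Statement 8.** (Free covers of a strict exact sequence of submodules.)
Let `A ⊆ F_A`, `B ⊆ F_B`, `C ⊆ F_C` be submodules of finitely generated free
`Dₙ`-modules with shift vectors, carrying the intersection filtrations, and let
`0 → A → B → C → 0` be exact and `V_d`-strict.  Then there are finitely
generated free modules `P_A`, `P_C`, `P_B = P_A ⊕ P_C` with shift vectors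
`𝔪_A, 𝔪_C, 𝔪_B = (𝔪_A, 𝔪_C)` and surjections `p_X : P_X ↠ X` forming a
commutative diagram over `0 → A → B → C → 0`, whose kernels `K_X = ker p_X`
(with intersection filtrations) again form a short exact sequence, such that
all rows and columns of the diagram are exact and `V_d`-strict, i.e. exact on
every filtration level `F^j`. -/
theorem strict_free_cover_of_strict_sequence
    (n d : ℕ) (hd : d ≤ n) (fa fb fc : ℕ)
    (𝔪a : Fin fa → ℤ) (𝔪b : Fin fb → ℤ) (𝔪c : Fin fc → ℤ)
    (A : Submodule (Weyl n) (Fin fa → Weyl n))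
    (B : Submodule (Weyl n) (Fin fb → Weyl n))
    (C : Submodule (Weyl n) (Fin fc → Weyl n))
    (α : A →ₗ[Weyl n] B) (γ : B →ₗ[Weyl n] C)
    (hinj : Function.Injective α) (hsurj : Function.Surjective γ)
    (hexact : ∀ y : B, γ y = 0 ↔ ∃ x : A, α x = y)
    -- the given sequence is V_d-strict (and V_d-adapted)
    (hadA : ∀ j : ℤ, ∀ x ∈ VfilSub n d 𝔪a A j, α x ∈ VfilSub n d 𝔪b B j)
    (hadB : ∀ j : ℤ, ∀ y ∈ VfilSub n d 𝔪b B j, γ y ∈ VfilSub n d 𝔪c C j)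
    (hstrM : ∀ j : ℤ, ∀ y ∈ VfilSub n d 𝔪b B j, γ y = 0 →
      ∃ x ∈ VfilSub n d 𝔪a A j, α x = y)
    (hstrR : ∀ j : ℤ, ∀ z ∈ VfilSub n d 𝔪c C j,
      ∃ y ∈ VfilSub n d 𝔪b B j, γ y = z) :
    ∃ (pa pc : ℕ) (𝔪A : Fin pa → ℤ) (𝔪C : Fin pc → ℤ)
      (pA : (Fin pa → Weyl n) →ₗ[Weyl n] A)
      (pC : (Fin pc → Weyl n) →ₗ[Weyl n] C)
      (pB : ((Fin pa → Weyl n) × (Fin pc → Weyl n)) →ₗ[Weyl n] B),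
      Function.Surjective pA ∧ Function.Surjective pB ∧ Function.Surjective pC ∧
      -- commutativity of the diagram (rows built from inclusion/projection)
      (∀ u, pB (u, 0) = α (pA u)) ∧
      (∀ u v, γ (pB (u, v)) = pC v) ∧
      -- the columns `0 → K_X → P_X → X → 0` are strict: surjective on every level
      (∀ j : ℤ, ∀ u ∈ VfilFree n d 𝔪A j, pA u ∈ VfilSub n d 𝔪a A j) ∧
      (∀ j : ℤ, ∀ x ∈ VfilSub n d 𝔪a A j, ∃ u ∈ VfilFree n d 𝔪A j, pA u = x) ∧
      (∀ j : ℤ, ∀ w : (Fin pa → Weyl n) × (Fin pc → Weyl n),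
        w.1 ∈ VfilFree n d 𝔪A j → w.2 ∈ VfilFree n d 𝔪C j →
          pB w ∈ VfilSub n d 𝔪b B j) ∧
      (∀ j : ℤ, ∀ y ∈ VfilSub n d 𝔪b B j,
        ∃ w : (Fin pa → Weyl n) × (Fin pc → Weyl n),
          w.1 ∈ VfilFree n d 𝔪A j ∧ w.2 ∈ VfilFree n d 𝔪C j ∧ pB w = y) ∧
      (∀ j : ℤ, ∀ v ∈ VfilFree n d 𝔪C j, pC v ∈ VfilSub n d 𝔪c C j) ∧
      (∀ j : ℤ, ∀ z ∈ VfilSub n d 𝔪c C j, ∃ v ∈ VfilFree n d 𝔪C j, pC v = z) ∧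
      -- the kernel row `0 → K_A → K_B → K_C → 0` is exact …
      (∀ u, pA u = 0 → pB (u, 0) = 0) ∧
      (∀ u v, pB (u, v) = 0 → pC v = 0) ∧
      (∀ u, pB (u, 0) = 0 → pA u = 0) ∧
      (∀ v, pC v = 0 → ∃ u, pB (u, v) = 0) ∧
      -- … and V_d-strict
      (∀ j : ℤ, ∀ v ∈ VfilFree n d 𝔪C j, pC v = 0 →
        ∃ u ∈ VfilFree n d 𝔪A j, pB (u, v) = 0) ∧
      (∀ j : ℤ, ∀ u ∈ VfilFree n d 𝔪A j, ∀ v ∈ VfilFree n d 𝔪C j,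
        pB (u, v) = 0 → v = 0 → pA u = 0) := by
  obtain ⟨pa, sA, gA, hgA, genA⟩ := exists_finite_strict_generators n d 𝔪a A
  obtain ⟨pc, sC, gC, hgC, genC⟩ := exists_finite_strict_generators n d 𝔪c C
  choose b hb hbC using fun k => hstrR (sC k) (gC k) (hgC k)
  let pA : (Fin pa → Weyl n) →ₗ[Weyl n] A := Fintype.linearCombination (Weyl n) gA
  let pC : (Fin pc → Weyl n) →ₗ[Weyl n] C := Fintype.linearCombination (Weyl n) gC
  let lift : (Fin pc → Weyl n) →ₗ[Weyl n] B := Fintype.linearCombination (Weyl n) b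
  let pB := (α ∘ₗ pA).coprod lift
  have hpB (u v) : pB (u, v) = α (pA u) + lift v := rfl
  have hlift (v) : γ (lift v) = pC v := by
    change γ (∑ k, v k • b k) = ∑ k, v k • gC k
    simp only [map_sum, map_smul, hbC]
  have hγα (x) : γ (α x) = 0 := (hexact _).2 ⟨x, rfl⟩
  have hpBC (u v) : γ (pB (u, v)) = pC v := by
    rw [hpB, map_add, hγα, zero_add, hlift]
  have hpB0 (u) : pB (u, 0) = α (pA u) := by rw [hpB, map_zero, add_zero]
  have filA (j u) (hu : u ∈ VfilFree n d sA j) : pA u ∈ VfilSub n d 𝔪a A j :=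
    sum_smul_mem_VfilSub hgA hu
  have filC (j v) (hv : v ∈ VfilFree n d sC j) : pC v ∈ VfilSub n d 𝔪c C j :=
    sum_smul_mem_VfilSub hgC hv
  have fil_lift (j v) (hv : v ∈ VfilFree n d sC j) : lift v ∈ VfilSub n d 𝔪b B j :=
    sum_smul_mem_VfilSub hb hv
  have filB (j) (w : (Fin pa → Weyl n) × (Fin pc → Weyl n)) (hu : w.1 ∈ VfilFree n d sA j)
      (hv : w.2 ∈ VfilFree n d sC j) : pB w ∈ VfilSub n d 𝔪b B j := fun i =>
    add_mem (hadA j _ (filA j _ hu) i) (fil_lift j _ hv i)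
  have strictB (j) (y) (hy : y ∈ VfilSub n d 𝔪b B j) :
      ∃ w : (Fin pa → Weyl n) × (Fin pc → Weyl n),
        w.1 ∈ VfilFree n d sA j ∧ w.2 ∈ VfilFree n d sC j ∧ pB w = y := by
    obtain ⟨v, hv, hvy⟩ := genC j (γ y) (hadB j y hy)
    have hrest : y - lift v ∈ VfilSub n d 𝔪b B j := fun i =>
      sub_mem (hy i) (fil_lift j v hv i)
    obtain ⟨x, hx, hxy⟩ := hstrM j _ hrest (by rw [map_sub, hlift]; exact sub_eq_zero.2 hvy.symm)
    obtain ⟨u, hu, hux⟩ := genA j x hx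
    have hux' : pA u = x := hux
    exact ⟨(u, v), hu, hv, by rw [hpB, hux', hxy, sub_add_cancel]⟩
  have hsurjA : Function.Surjective pA := fun x =>
    have ⟨j, hj⟩ := exists_mem_VfilSub d 𝔪a x
    have ⟨u, _, hu⟩ := genA j x hj
    ⟨u, hu⟩
  have hsurjC : Function.Surjective pC := fun x =>
    have ⟨j, hj⟩ := exists_mem_VfilSub d 𝔪c x
    have ⟨u, _, hu⟩ := genC j x hj
    ⟨u, hu⟩
  have hsurjB : Function.Surjective pB := fun y =>
    have ⟨j, hj⟩ := exists_mem_VfilSub d 𝔪b y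
    have ⟨w, _, _, hw⟩ := strictB j y hj
    ⟨w, hw⟩
  have hker (u) (hu : pB (u, 0) = 0) : pA u = 0 :=
    hinj (by rw [← hpB0, hu, map_zero])
  refine ⟨pa, pc, sA, sC, pA, pC, pB, hsurjA, hsurjB, hsurjC, hpB0, hpBC, filA, genA, filB,
    strictB, filC, genC, fun u hu => by rw [hpB0, hu, map_zero],
    fun u v h => by rw [← hpBC u v, h, map_zero], hker, fun v hv => ?_, fun j v hv hv0 => ?_,
    fun j u _ v _ h hv0 => hker u (hv0 ▸ h)⟩
  · obtain ⟨x, hx⟩ := (hexact (lift v)).1 (by rw [hlift, hv])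
    obtain ⟨u, hu⟩ := hsurjA x
    exact ⟨-u, by rw [hpB, map_neg, map_neg, hu, hx, neg_add_cancel]⟩
  · obtain ⟨x, hx, hxv⟩ := hstrM j (lift v) (fil_lift j v hv) (by rw [hlift, hv0])
    obtain ⟨u, hu, hux⟩ := genA j x hx
    have hux' : pA u = x := hux
    exact ⟨-u, fun i => neg_mem (hu i), by
      rw [hpB, map_neg, map_neg, hux', hxv, neg_add_cancel]⟩
end
end

section
/- In the first Weyl algebra D₁ with the V₁-filtration, the element 1 lies in F^0(D₁) and satisfies 1 = 1·∂₁ − 1·(∂₁ − 1), so 1 ∈ F^0(D₁)·∂₁ + F^0(D₁)·(∂₁ − 1); nevertheless there exist no operators P, Q ∈ F^{−1}(D₁) with P·∂₁ + Q·(∂₁ − 1) = 1. (Consequently the total complex of a double complex with V_d-strict rows and columns need not be V_d-strict.) -/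
set_option synthInstance.maxHeartbeats 1000000
set_option maxHeartbeats 4000000
set_option linter.unusedVariables false

open scoped TensorProduct

noncomputable section

theorem one_mem_Vfil_zero : (1 : Weyl 1) ∈ Vfil 1 1 0 :=
  Submodule.subset_span ⟨0, 0, by simp [wmono], by simp⟩

/-- For `j < 0`, every operator in `F^j(D₁)` has its image in the ideal `(x)`. -/
theorem constantCoeff_apply_eq_zero_of_mem_Vfil {j : ℤ} (hj : j < 0) {P : Weyl 1}
    (hP : P ∈ Vfil 1 1 j) (f : Rp 1) : MvPolynomial.constantCoeff (P.1 f) = 0 := by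
  induction hP using Submodule.span_induction with
  | mem w hw =>
    obtain ⟨α, β, rfl, h⟩ := hw
    obtain ⟨a, ha⟩ : ∃ a, α 0 = a + 1 := Nat.exists_eq_succ_of_ne_zero (by
      intro h0
      simp [h0] at h
      omega)
    have hw : wmono α β = wx 0 * ((wx 0) ^ a * (wd 0) ^ (β 0)) := by
      simp [wmono, ha, pow_succ', mul_assoc]
    rw [hw]
    change MvPolynomial.constantCoeff
      (MvPolynomial.X 0 * ((wx 0) ^ a * (wd 0) ^ (β 0) : Weyl 1).1 f) = 0
    simp
  | zero => exact map_zero _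
  | add P Q _ _ hP hQ =>
    change MvPolynomial.constantCoeff (P.1 f + Q.1 f) = 0
    rw [map_add, hP, hQ, add_zero]
  | smul c P _ hP =>
    change MvPolynomial.constantCoeff (c • P.1 f) = 0
    rw [MvPolynomial.smul_eq_C_mul, map_mul, hP, mul_zero]

/-- **Statement 10.** In the first Weyl algebra `D₁` with the `V₁`-filtration,
the element `1` lies in `F⁰(D₁)` and satisfies `1 = 1·∂₁ − 1·(∂₁ − 1)`, so
`1 ∈ F⁰(D₁)·∂₁ + F⁰(D₁)·(∂₁ − 1)`; nevertheless there are no operators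
`P, Q ∈ F⁻¹(D₁)` with `P·∂₁ + Q·(∂₁ − 1) = 1`.  (Consequently, the total
complex of a double complex with `V_d`-strict rows and columns need not be
`V_d`-strict.) -/
theorem weyl_total_complex_not_strict_example :
    (1 : Weyl 1) ∈ Vfil 1 1 0 ∧
    (1 : Weyl 1) = 1 * wd 0 - 1 * (wd 0 - 1) ∧
    (∃ P Q : Weyl 1, P ∈ Vfil 1 1 0 ∧ Q ∈ Vfil 1 1 0 ∧
      P * wd 0 + Q * (wd 0 - 1) = 1) ∧
    ¬ (∃ P Q : Weyl 1, P ∈ Vfil 1 1 (-1) ∧ Q ∈ Vfil 1 1 (-1) ∧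
      P * wd 0 + Q * (wd 0 - 1) = 1) := by
  refine ⟨one_mem_Vfil_zero, by simp, ⟨1, -1, one_mem_Vfil_zero, ?_, by simp⟩, ?_⟩
  · exact (Vfil 1 1 0).neg_mem one_mem_Vfil_zero
  · rintro ⟨P, Q, hP, hQ, h⟩
    have h1 : P.1 ((wd 0 : Weyl 1).1 1) + Q.1 ((wd 0 - 1 : Weyl 1).1 1) = 1 :=
      congrArg (fun T : Weyl 1 => T.1 1) h
    have h2 := congrArg MvPolynomial.constantCoeff h1
    rw [map_add, constantCoeff_apply_eq_zero_of_mem_Vfil (by norm_num) hP,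
      constantCoeff_apply_eq_zero_of_mem_Vfil (by norm_num) hQ] at h2
    simp at h2
end
end

section
/- Fix 1 ≤ d ≤ n. Let L^• be a complex of graded D_n-modules (for level d) with degree-preserving differentials, and let b ∈ ℂ[s] be a polynomial such that for all integers i and j, b(θ_d + j)·ker(L^i_j → L^{i+1}_j) ⊆ im(L^{i−1}_j → L^i_j), where b(θ_d + j) denotes the operator obtained by substituting θ_d + j for s in b. Then for every integer k with b(k) ≠ 0, the complex K^•(L^•, x₁,…,x_d)[k] is exact. -/
set_option synthInstance.maxHeartbeats 1000000
set_option maxHeartbeats 4000000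
set_option linter.unusedVariables false

open scoped TensorProduct

noncomputable section

/-- The sign `(-1)^t` for `t : ℤ`. -/
def zsign (t : ℤ) : ℤ := if Even t then 1 else -1

section GradedKoszul

variable (n d : ℕ)

/-- Subsets of `{1,…,d}`, indexing a basis of `Λ^•(ℤ^d)`. -/
def KIdx : Type := { S : Finset (Fin n) // ∀ l ∈ S, (l : ℕ) < d }

variable (L : ℤ → ℤ → Type) [∀ i j, AddCommGroup (L i j)] [∀ i j, Module ℂ (L i j)]

/-- The Koszul total complex `K^•(L^•, x₁,…,x_d)[k]` of a complex `L^•` of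
graded modules: its entry in total degree `m` collects, over the basis
`e_S` (`S ⊆ {1,…,d}`, `|S| = s`) of `Λ^s(ℤ^d)`, the graded pieces
`L^{m-s}_{k+d-s}`. -/
def KT (k m : ℤ) : Type :=
  (S : KIdx n d) → L (m - S.1.card) (k + d - S.1.card)

instance (k m : ℤ) : AddCommGroup (KT n d L k m) :=
  inferInstanceAs (AddCommGroup ((S : KIdx n d) → L (m - S.1.card) (k + d - S.1.card)))

variable (xA : ∀ (_ : Fin n) (i j i' j' : ℤ), L i j →ₗ[ℂ] L i' j')
variable (δ : ∀ (i j i' j' : ℤ), L i j →ₗ[ℂ] L i' j')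

/-- The differential of the Koszul total complex
`K^•(L^•, x₁,…,x_d)[k]` (equal to `0` unless `m' = m + 1`): the differential
`δ` of `L^•` plus `(-1)^{(L-degree)}` times the Koszul differential
`u ⊗ e_S ↦ Σ_{l} x_l·u ⊗ e_l ∧ e_S`. -/
def kD (k m m' : ℤ) : KT n d L k m → KT n d L k m' := fun u =>
  if _h : m' = m + 1 then
    fun S =>
      δ (m - S.1.card) (k + d - S.1.card) (m' - S.1.card) (k + d - S.1.card) (u S) +
      zsign (m' - S.1.card) •
        (∑ l ∈ S.1.attach,
          zsign ((S.1.filter (fun x => x < l.1)).card) •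
            (xA l.1 (m - ((S.1.erase l.1).card : ℤ)) (k + d - ((S.1.erase l.1).card : ℤ))
              (m' - S.1.card) (k + d - S.1.card)
              (u ⟨S.1.erase l.1, fun x hx => S.2 x (Finset.mem_of_mem_erase hx)⟩)))
  else 0

end GradedKoszul

/-! ### Anticommutation identities in a ring -/

section RingIdentities

variable {R I : Type*} [Ring R] (s : Finset I) (X Y e c : I → R)

/-- The Koszul operator `∑ xₗ eₗ` squares to zero. -/
theorem koszul_sq_eq_zero [IsAddTorsionFree R]
    (hXX : ∀ l ∈ s, ∀ m ∈ s, X l * X m = X m * X l)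
    (hXe : ∀ l m, X l * e m = e m * X l)
    (hee : ∀ l m, e l * e m = -(e m * e l)) :
    (∑ l ∈ s, X l * e l) * (∑ l ∈ s, X l * e l) = 0 := by
  refine self_eq_neg.mp ?_
  rw [Finset.sum_mul_sum]
  conv_rhs => rw [Finset.sum_comm, ← Finset.sum_neg_distrib]
  refine Finset.sum_congr rfl fun l hl => ?_
  rw [← Finset.sum_neg_distrib]
  refine Finset.sum_congr rfl fun m hm => ?_
  calc X l * e l * (X m * e m) = X l * (e l * X m) * e m := by noncomm_ring
    _ = X l * X m * (e l * e m) := by rw [← hXe]; noncomm_ring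
    _ = -(X m * (X l * e m) * e l) := by rw [hXX l hl m hm, hee]; noncomm_ring
    _ = -(X m * e m * (X l * e l)) := by rw [hXe]; noncomm_ring

/-- The anticommutator of the Koszul operator `∑ xₗ eₗ` with the contraction
`∑ ∂ₗ cₗ` is `∑ xₗ ∂ₗ + ∑ cₗ eₗ`. -/
theorem koszul_anticommutator [DecidableEq I]
    (hYX : ∀ l ∈ s, Y l * X l = X l * Y l + 1)
    (hYX' : ∀ l ∈ s, ∀ m ∈ s, l ≠ m → Y l * X m = X m * Y l)
    (hXc : ∀ l m, X l * c m = c m * X l) (hYe : ∀ l m, Y l * e m = e m * Y l)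
    (hec : ∀ l, e l * c l + c l * e l = 1)
    (hec' : ∀ l m, l ≠ m → e l * c m + c m * e l = 0) :
    (∑ l ∈ s, X l * e l) * (∑ l ∈ s, Y l * c l) +
      (∑ l ∈ s, Y l * c l) * (∑ l ∈ s, X l * e l) =
      ∑ l ∈ s, X l * Y l + ∑ l ∈ s, c l * e l := by
  rw [Finset.sum_mul_sum, Finset.sum_mul_sum]
  conv_lhs => arg 2; rw [Finset.sum_comm]
  rw [← Finset.sum_add_distrib, ← Finset.sum_add_distrib]
  refine Finset.sum_congr rfl fun l hl => ?_
  rw [← Finset.sum_add_distrib]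
  have key : ∀ m ∈ s, X l * e l * (Y m * c m) + Y m * c m * (X l * e l) =
      if l = m then X l * Y l + c l * e l else 0 := by
    intro m hm
    have h1 : X l * e l * (Y m * c m) + Y m * c m * (X l * e l) =
        X l * Y m * (e l * c m) + Y m * X l * (c m * e l) := by
      calc _ = X l * (e l * Y m) * c m + Y m * (c m * X l) * e l := by noncomm_ring
        _ = _ := by rw [← hYe, ← hXc]; noncomm_ring
    rw [h1]
    split_ifs with h
    · subst h
      rw [hYX l hl]
      calc _ = X l * Y l * (e l * c l + c l * e l) + c l * e l := by noncomm_ring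
        _ = _ := by rw [hec, mul_one]
    · rw [hYX' m hm l hl (Ne.symm h), ← mul_add, hec' l m h, mul_zero]
  rw [Finset.sum_congr rfl key]
  simp [hl]

variable (Δ σ K h : R)

theorem total_sq_eq_zero (hΔΔ : Δ * Δ = 0) (hΔσ : Δ * σ = -(σ * Δ)) (hΔK : Δ * K = K * Δ)
    (hσK : σ * K = K * σ) (hKK : K * K = 0) : (Δ + σ * K) * (Δ + σ * K) = 0 := by
  calc (Δ + σ * K) * (Δ + σ * K)
      = Δ * Δ + Δ * σ * K + σ * (K * Δ) + σ * (K * σ) * K := by noncomm_ring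
    _ = Δ * Δ + σ * σ * (K * K) := by rw [hΔσ, ← hΔK, ← hσK]; noncomm_ring
    _ = 0 := by rw [hΔΔ, hKK]; simp

theorem total_anticommutator (hΔσ : Δ * σ = -(σ * Δ)) (hΔh : Δ * h = h * Δ)
    (hσK : σ * K = K * σ) (hσh : σ * h = h * σ) (hσσ : σ * σ = 1) :
    (Δ + σ * K) * (σ * h) + (σ * h) * (Δ + σ * K) = K * h + h * K := by
  calc (Δ + σ * K) * (σ * h) + (σ * h) * (Δ + σ * K)
      = Δ * σ * h + σ * (K * σ) * h + σ * (h * Δ) + σ * (h * σ) * K := by noncomm_ring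
    _ = σ * σ * (K * h + h * K) := by rw [hΔσ, ← hΔh, ← hσK, ← hσh]; noncomm_ring
    _ = K * h + h * K := by rw [hσσ, one_mul]

end RingIdentities

/-! ### Exterior multiplication and contraction on functions of finite sets -/

section Exterior

variable {I : Type*} [LinearOrder I]

/-- The sign of `e_l ∧ e_S` (or of the contraction of `e_l` with `e_S`). -/
def wedgeSign (l : I) (S : Finset I) : ℤ := (-1) ^ (S.filter (fun x => x < l)).card

theorem wedgeSign_mul_self (l : I) (S : Finset I) : wedgeSign l S * wedgeSign l S = 1 := by
  rw [wedgeSign, ← pow_add, ← two_mul, pow_mul]; simp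

theorem wedgeSign_insert {l m : I} {S : Finset I} (hl : l ∉ S) :
    wedgeSign m (insert l S) = (if l < m then -1 else 1) * wedgeSign m S := by
  unfold wedgeSign
  rw [Finset.filter_insert]
  split_ifs with h
  · rw [Finset.card_insert_of_notMem (by simp [hl]), pow_succ]; ring
  · rw [one_mul]

theorem wedgeSign_erase {l m : I} {S : Finset I} (hl : l ∈ S) :
    wedgeSign m (S.erase l) = (if l < m then -1 else 1) * wedgeSign m S := by
  have h := wedgeSign_insert (m := m) (Finset.notMem_erase l S)
  rw [Finset.insert_erase hl] at h
  rw [h, ← mul_assoc]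
  split_ifs <;> simp

variable (M : Type*) [AddCommGroup M] [Module ℂ M]

/-- Left exterior multiplication by `e_l`. -/
def wedge (l : I) : Module.End ℂ (Finset I → M) where
  toFun u S := if l ∈ S then wedgeSign l S • u (S.erase l) else 0
  map_add' u v := by ext S; dsimp only [Pi.add_apply]; split_ifs <;> simp
  map_smul' a u := by
    ext S; dsimp only [Pi.smul_apply, RingHom.id_apply]
    split_ifs
    · rw [smul_comm]
    · simp

/-- Contraction with the dual of `e_l`. -/
def contract (l : I) : Module.End ℂ (Finset I → M) where
  toFun u S := if l ∈ S then 0 else wedgeSign l S • u (insert l S)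
  map_add' u v := by ext S; dsimp only [Pi.add_apply]; split_ifs <;> simp
  map_smul' a u := by
    ext S; dsimp only [Pi.smul_apply, RingHom.id_apply]
    split_ifs
    · simp
    · rw [smul_comm]

/-- Pointwise application of an endomorphism. -/
def pointwise : Module.End ℂ M →+* Module.End ℂ (Finset I → M) where
  toFun A := { toFun := fun u S => A (u S)
               map_add' := fun u v => by ext S; simp
               map_smul' := fun a u => by ext S; simp }
  map_one' := rfl
  map_mul' _ _ := rfl
  map_zero' := rfl
  map_add' _ _ := rfl

variable {M}

theorem wedge_apply (l : I) (u : Finset I → M) (S : Finset I) :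
    wedge M l u S = if l ∈ S then wedgeSign l S • u (S.erase l) else 0 := rfl

theorem contract_apply (l : I) (u : Finset I → M) (S : Finset I) :
    contract M l u S = if l ∈ S then 0 else wedgeSign l S • u (insert l S) := rfl

theorem pointwise_apply {I : Type*} (A : Module.End ℂ M) (u : Finset I → M) (S : Finset I) :
    pointwise M A u S = A (u S) := rfl

theorem pointwise_mul_wedge (A : Module.End ℂ M) (l : I) :
    pointwise M A * wedge M l = wedge M l * pointwise M A := by
  ext u S
  simp only [Module.End.mul_apply, pointwise_apply, wedge_apply]
  split_ifs <;> simp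

theorem pointwise_mul_contract (A : Module.End ℂ M) (l : I) :
    pointwise M A * contract M l = contract M l * pointwise M A := by
  ext u S
  simp only [Module.End.mul_apply, pointwise_apply, contract_apply]
  split_ifs <;> simp

theorem wedge_mul_wedge (l m : I) : wedge M l * wedge M m = -(wedge M m * wedge M l) := by
  ext u S
  simp only [Module.End.mul_apply, LinearMap.neg_apply, Pi.neg_apply, wedge_apply]
  rcases eq_or_ne l m with rfl | hlm
  · simp
  by_cases hl : l ∈ S <;> by_cases hm : m ∈ S <;>
    simp only [hl, hm, Finset.mem_erase, hlm, hlm.symm, if_true, if_false, ne_eq, not_false_eq_true,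
      and_true, and_false, smul_zero, neg_zero]
  rw [smul_smul, smul_smul, wedgeSign_erase hl, wedgeSign_erase hm, Finset.erase_right_comm,
    ← neg_smul]
  congr 1
  rcases lt_or_gt_of_ne hlm with h | h <;> simp [h, h.not_gt] <;> ring

theorem wedge_contract_self (l : I) :
    wedge M l * contract M l + contract M l * wedge M l = 1 := by
  ext u S
  simp only [Module.End.mul_apply, LinearMap.add_apply, Pi.add_apply, wedge_apply, contract_apply,
    Module.End.one_apply]
  by_cases hl : l ∈ S
  · simp [hl, smul_smul, wedgeSign_erase hl, wedgeSign_mul_self]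
  · simp [hl, smul_smul, wedgeSign_insert hl, wedgeSign_mul_self]

theorem wedge_contract_of_ne {l m : I} (hlm : l ≠ m) :
    wedge M l * contract M m + contract M m * wedge M l = 0 := by
  ext u S
  simp only [Module.End.mul_apply, LinearMap.add_apply, Pi.add_apply, wedge_apply, contract_apply,
    LinearMap.zero_apply, Pi.zero_apply]
  by_cases hl : l ∈ S <;> by_cases hm : m ∈ S <;>
    simp only [hl, hm, Finset.mem_erase, Finset.mem_insert, hlm, hlm.symm, if_true, if_false,
      ne_eq, not_false_eq_true, and_true, and_false, smul_zero, add_zero, or_true, or_false]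
  rw [smul_smul, smul_smul, wedgeSign_erase hl, wedgeSign_insert hm,
    Finset.erase_insert_of_ne hlm.symm, ← add_smul]
  convert zero_smul ℤ _
  rcases lt_or_gt_of_ne hlm with h | h <;> simp [h, h.not_gt] <;> ring

theorem sum_contract_wedge_apply (s : Finset I) (u : Finset I → M) (S : Finset I) :
    (∑ l ∈ s, contract M l * wedge M l) u S = ((s \ S).card : ℂ) • u S := by
  have h : ∀ l, (contract M l * wedge M l) u S = if l ∈ S then 0 else u S := by
    intro l
    simp only [Module.End.mul_apply, wedge_apply, contract_apply]
    by_cases hl : l ∈ S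
    · simp [hl]
    · simp [hl, smul_smul, wedgeSign_insert hl, wedgeSign_mul_self]
  rw [LinearMap.sum_apply, Finset.sum_apply, Finset.sum_congr rfl fun l _ => h l,
    Finset.sum_ite, Finset.sum_const_zero, zero_add, Finset.sum_const, Nat.cast_smul_eq_nsmul,
    Finset.sdiff_eq_filter]

end Exterior

/-! ### Polynomials in endomorphisms -/

theorem aeval_intertwine {M N : Type*} [AddCommGroup M] [Module ℂ M] [AddCommGroup N] [Module ℂ N]
    (φ : M →ₗ[ℂ] N) (A : Module.End ℂ M) (B : Module.End ℂ N)
    (h : ∀ u, φ (A u) = B (φ u)) (b : Polynomial ℂ) (u : M) :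
    φ (Polynomial.aeval A b u) = Polynomial.aeval B b (φ u) := by
  induction b using Polynomial.induction_on generalizing u with
  | C a => simp [Module.algebraMap_end_apply]
  | add p q hp hq => simp [hp, hq]
  | monomial m a ih =>
    rw [pow_succ, ← mul_assoc, map_mul (Polynomial.aeval A), map_mul (Polynomial.aeval B),
      Polynomial.aeval_X, Polynomial.aeval_X, Module.End.mul_apply, Module.End.mul_apply, ih, h]

/-- A polynomial in `E` preserves a submodule stable under `E`. -/
theorem aeval_mem {M : Type*} [AddCommGroup M] [Module ℂ M] (U : Submodule ℂ M)
    (A : Module.End ℂ M) (h : ∀ u ∈ U, A u ∈ U) (b : Polynomial ℂ) (u : M) (hu : u ∈ U) :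
    Polynomial.aeval A b u ∈ U := by
  have key := aeval_intertwine U.subtype (A.restrict h) A (fun _ => rfl) b ⟨u, hu⟩
  rw [Submodule.subtype_apply, Submodule.subtype_apply] at key
  rw [← key]
  exact Subtype.property _

/-! ### Exactness of the total complex -/

section Exactness

variable {I M : Type*} [LinearOrder I] [AddCommGroup M] [Module ℂ M]

/-- The total differential `Δ + σ ∑ xₗ eₗ` on `M ⊗ Λ`. -/
def totalD (s : Finset I) (X : I → Module.End ℂ M) (Δ σ : Module.End ℂ M) :
    Module.End ℂ (Finset I → M) :=
  pointwise M Δ + pointwise M σ * ∑ l ∈ s, pointwise M (X l) * wedge M l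

theorem totalD_apply (s : Finset I) (X : I → Module.End ℂ M) (Δ σ : Module.End ℂ M)
    (v : Finset I → M) (S : Finset I) :
    totalD s X Δ σ v S =
      Δ (v S) + σ (∑ l ∈ s, if l ∈ S then wedgeSign l S • X l (v (S.erase l)) else 0) := by
  simp only [totalD, LinearMap.add_apply, Pi.add_apply, Module.End.mul_apply, pointwise_apply,
    LinearMap.sum_apply, Finset.sum_apply, wedge_apply]
  congr 2
  refine Finset.sum_congr rfl fun l _ => ?_
  split_ifs <;> simp

/-- If a polynomial `b` in `∑ xₗ ∂ₗ + #(s \ S) + k` kills the `Δ`-cohomology of the subcomplexes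
`U S`, and `b(k) ≠ 0`, then the total complex is exact at families in `∏ U S`. -/
theorem totalD_exact (s : Finset I) (X Y : I → Module.End ℂ M) (Δ σ : Module.End ℂ M)
    (hXX : ∀ l ∈ s, ∀ m ∈ s, X l * X m = X m * X l)
    (hYX : ∀ l ∈ s, Y l * X l = X l * Y l + 1)
    (hYX' : ∀ l ∈ s, ∀ m ∈ s, l ≠ m → Y l * X m = X m * Y l)
    (hΔX : ∀ l ∈ s, Δ * X l = X l * Δ) (hΔY : ∀ l ∈ s, Δ * Y l = Y l * Δ)
    (hσX : ∀ l ∈ s, σ * X l = X l * σ) (hσY : ∀ l ∈ s, σ * Y l = Y l * σ)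
    (hΔΔ : Δ * Δ = 0) (hΔσ : Δ * σ = -(σ * Δ)) (hσσ : σ * σ = 1)
    (b : Polynomial ℂ) (k : ℂ) (hk : b.eval k ≠ 0) (U : Finset I → Submodule ℂ M)
    (hUΔ : ∀ S, ∀ f ∈ U S, Δ f ∈ U S) (hUσ : ∀ S, ∀ f ∈ U S, σ f ∈ U S)
    (hUX : ∀ l ∈ s, ∀ S, l ∈ S → ∀ f ∈ U (S.erase l), X l f ∈ U S)
    (hUΘ : ∀ S, ∀ f ∈ U S, (∑ l ∈ s, X l * Y l) f ∈ U S)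
    (hUs : ∀ S, ¬ S ⊆ s → U S = ⊥)
    (hb : ∀ S, ∀ f ∈ U S, Δ f = 0 → ∃ g ∈ U S,
      Δ g = Polynomial.aeval (∑ l ∈ s, X l * Y l +
        (((s \ S).card : ℂ) + k) • (1 : Module.End ℂ M)) b f)
    (u : Finset I → M) (hu : ∀ S, u S ∈ U S) (hDu : totalD s X Δ σ u = 0) :
    ∃ v, totalD s X Δ σ v = u := by
  set D := totalD s X Δ σ with hD
  set K : Module.End ℂ (Finset I → M) := ∑ l ∈ s, pointwise M (X l) * wedge M l with hK
  set h : Module.End ℂ (Finset I → M) := ∑ l ∈ s, pointwise M (Y l) * contract M l with hh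
  have tf : IsAddTorsionFree (Module.End ℂ (Finset I → M)) :=
    IsAddTorsionFree.of_isTorsionFree ℂ _
  have comm_sum : ∀ (A : Module.End ℂ M) (Z : I → Module.End ℂ M)
      (e : I → Module.End ℂ (Finset I → M)), (∀ l, pointwise M A * e l = e l * pointwise M A) →
      (∀ l ∈ s, A * Z l = Z l * A) →
      pointwise M A * (∑ l ∈ s, pointwise M (Z l) * e l) =
        (∑ l ∈ s, pointwise M (Z l) * e l) * pointwise M A := by
    intro A Z e he hZ
    rw [Finset.mul_sum, Finset.sum_mul]
    refine Finset.sum_congr rfl fun l hl => ?_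
    rw [← mul_assoc, ← map_mul, hZ l hl, map_mul, mul_assoc, he, mul_assoc]
  have hKK : K * K = 0 := koszul_sq_eq_zero s _ _
    (fun l hl m hm => by rw [← map_mul, hXX l hl m hm, map_mul])
    (fun l m => pointwise_mul_wedge _ _) wedge_mul_wedge
  have hKh : K * h + h * K = _ := koszul_anticommutator s (fun l => pointwise M (X l))
    (fun l => pointwise M (Y l)) (wedge M) (contract M)
    (fun l hl => by rw [← map_mul, hYX l hl, map_add, map_mul, map_one])
    (fun l hl m hm hlm => by rw [← map_mul, hYX' l hl m hm hlm, map_mul])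
    (fun l m => pointwise_mul_contract _ _) (fun l m => pointwise_mul_wedge _ _)
    wedge_contract_self (fun l m => wedge_contract_of_ne)
  have hΔσ' : pointwise (I := I) M Δ * pointwise M σ = -(pointwise M σ * pointwise M Δ) := by
    rw [← map_mul, hΔσ, map_neg, map_mul]
  have hσK := comm_sum σ X _ (pointwise_mul_wedge σ) hσX
  have hDD : D * D = 0 := total_sq_eq_zero _ _ _
    (by rw [← map_mul, hΔΔ, map_zero]) hΔσ'
    (comm_sum Δ X _ (pointwise_mul_wedge Δ) hΔX) hσK hKK
  set H := pointwise M σ * h with hH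
  have hDH : D * H + H * D = K * h + h * K := total_anticommutator _ _ _ _ hΔσ'
    (comm_sum Δ Y _ (pointwise_mul_contract Δ) hΔY) hσK
    (comm_sum σ Y _ (pointwise_mul_contract σ) hσY) (by rw [← map_mul, hσσ, map_one])
  set E : Module.End ℂ (Finset I → M) := D * H + H * D + k • 1 with hE
  have hEapply : ∀ (c : Finset I → M) (S : Finset I), E c S =
      (∑ l ∈ s, X l * Y l + (((s \ S).card : ℂ) + k) • (1 : Module.End ℂ M)) (c S) := by
    intro c S
    have h1 := sum_contract_wedge_apply s c S
    rw [hE, hDH, hKh, LinearMap.add_apply, LinearMap.add_apply, Pi.add_apply, Pi.add_apply, h1]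
    simp [pointwise_apply, add_smul, add_assoc]
  have hDE : ∀ c, D (E c) = E (D c) := by
    intro c
    have : D * E = E * D := by
      calc D * E = (D * D) * H + D * H * D + k • D := by
            rw [hE, mul_add, mul_smul_comm, mul_one]; noncomm_ring
        _ = D * H * D + H * (D * D) + k • D := by rw [hDD]; simp
        _ = E * D := by rw [hE, add_mul, smul_mul_assoc, one_mul]; noncomm_ring
    exact LinearMap.congr_fun this c
  have hpD : ∀ (p : Polynomial ℂ) c, D (Polynomial.aeval E p c) = Polynomial.aeval E p (D c) :=
    fun p c => aeval_intertwine D E E hDE p c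
  have hpS : ∀ (p : Polynomial ℂ) c S, Polynomial.aeval E p c S = Polynomial.aeval
      (∑ l ∈ s, X l * Y l + (((s \ S).card : ℂ) + k) • (1 : Module.End ℂ M)) p (c S) :=
    fun p c S => aeval_intertwine (LinearMap.proj S) E _ (fun c => hEapply c S) p c
  have hUD : ∀ c : Finset I → M, (∀ S, c S ∈ U S) → ∀ S, D c S ∈ U S := by
    intro c hc S
    rw [hD, totalD_apply]
    refine add_mem (hUΔ S _ (hc S)) (hUσ S _ (sum_mem fun l hl => ?_))
    split_ifs with hlS
    · exact zsmul_mem (hUX l hl S hlS _ (hc _)) _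
    · exact zero_mem _
  suffices main : ∀ q p : ℕ, p + q = s.card + 1 → ∀ c : Finset I → M, (∀ S, c S ∈ U S) →
      (∀ S, S.card < p → c S = 0) → D c = 0 → ∃ v, D v = c from
    main (s.card + 1) 0 (by omega) u hu (by simp) hDu
  intro q
  induction q with
  | zero =>
    intro p hp c hcU hcp _
    refine ⟨0, ?_⟩
    rw [map_zero]
    ext S
    by_cases hS : S ⊆ s
    · rw [hcp S (by have := Finset.card_le_card hS; omega), Pi.zero_apply]
    · have := hcU S
      rw [hUs S hS, Submodule.mem_bot] at this
      rw [this, Pi.zero_apply]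
  | succ q ih =>
    intro p hp c hcU hcp hDc
    have hlow : ∀ w : Finset I → M, (∀ S, S.card < p → w S = 0) → ∀ S, S.card ≤ p →
        D w S = Δ (w S) := by
      intro w hw S hS
      rw [hD, totalD_apply, Finset.sum_eq_zero, map_zero, add_zero]
      intro l _
      split_ifs with hlS
      · have := Finset.card_erase_lt_of_mem hlS
        rw [hw _ (by omega), map_zero, smul_zero]
      · rfl
    have hg : ∀ S, ∃ g ∈ U S, (S.card ≠ p → g = 0) ∧
        (S.card = p → Δ g = Polynomial.aeval E b c S) := by
      intro S
      by_cases hS : S.card = p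
      · have h0 : Δ (c S) = 0 := by rw [← hlow c hcp S hS.le, hDc, Pi.zero_apply]
        obtain ⟨g, hgU, hg⟩ := hb S (c S) (hcU S) h0
        exact ⟨g, hgU, fun h => absurd hS h, fun _ => by rw [hg, hpS]⟩
      · exact ⟨0, zero_mem _, fun _ => rfl, fun h => absurd h hS⟩
    choose g hgU hg0 hg using hg
    obtain ⟨v, hv⟩ := ih (p + 1) (by omega) (Polynomial.aeval E b c - D g)
      (fun S => by
        refine sub_mem ?_ (hUD g hgU S)
        rw [hpS]
        refine aeval_mem (U S) _ (fun f hf => ?_) b _ (hcU S)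
        exact add_mem (hUΘ S f hf) (Submodule.smul_mem _ _ hf))
      (fun S hS => by
        rw [Pi.sub_apply, hlow g (fun T hT => hg0 T hT.ne) S (by omega)]
        rcases Nat.lt_succ_iff_lt_or_eq.mp hS with hS | hS
        · rw [hg0 S hS.ne, map_zero, hpS, hcp S hS, map_zero, sub_zero]
        · rw [hg S hS, sub_self])
      (by
        rw [map_sub, hpD, hDc, map_zero, ← Module.End.mul_apply, hDD, LinearMap.zero_apply,
          sub_zero])
    obtain ⟨r, hr⟩ := Polynomial.X_sub_C_dvd_sub_C_eval (a := k) (p := b)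
    have hbr : Polynomial.aeval E b c = b.eval k • c + D (H (Polynomial.aeval E r c)) := by
      have h1 : b = Polynomial.C (b.eval k) + (Polynomial.X - Polynomial.C k) * r := by
        rw [← hr]; ring
      have h2 : D (Polynomial.aeval E r c) = 0 := by rw [hpD, hDc, map_zero]
      conv_lhs => rw [h1]
      rw [map_add, map_mul, map_sub, Polynomial.aeval_C, Polynomial.aeval_C, Polynomial.aeval_X,
        LinearMap.add_apply, Module.End.mul_apply, LinearMap.sub_apply,
        Module.algebraMap_end_apply, Module.algebraMap_end_apply]
      congr 1
      have h3 : ∀ c', E c' = D (H c') + H (D c') + k • c' := fun c' => by simp [hE]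
      rw [h3, h2, map_zero, add_zero, add_sub_cancel_right]
    refine ⟨(b.eval k)⁻¹ • (v + g - H (Polynomial.aeval E r c)), ?_⟩
    rw [map_smul, map_sub, map_add, hv, hbr, sub_add_cancel, add_sub_cancel_right, smul_smul,
      inv_mul_cancel₀ hk, one_smul]

end Exactness

/-! ### Passing from the graded pieces to their product -/

theorem zsign_add_one (t : ℤ) : zsign (t + 1) = -zsign t := by
  unfold zsign
  by_cases h : Even t <;> simp [h, parity_simps]

theorem zsign_mul_self (t : ℤ) : zsign t * zsign t = 1 := by
  unfold zsign
  split_ifs <;> rfl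

theorem zsign_natCast (t : ℕ) : zsign t = (-1) ^ t := by
  induction t with
  | zero => simp [zsign]
  | succ t ih => rw [Nat.cast_succ, zsign_add_one, ih, pow_succ]; ring

section Pieces

variable {L : ℤ → ℤ → Type} [∀ i j, AddCommGroup (L i j)] [∀ i j, Module ℂ (L i j)]

/-- The endomorphism of `∏ L i j` of bidegree `(a, b)` given by a family of maps. -/
def shiftOp (A : ∀ i j i' j' : ℤ, L i j →ₗ[ℂ] L i' j') (a b : ℤ) :
    Module.End ℂ (∀ i j, L i j) :=
  LinearMap.pi fun i => LinearMap.pi fun j =>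
    (A (i - a) (j - b) i j).comp ((LinearMap.proj (j - b)).comp (LinearMap.proj (i - a)))

theorem shiftOp_apply (A : ∀ i j i' j' : ℤ, L i j →ₗ[ℂ] L i' j') {a b : ℤ} (f : ∀ i j, L i j)
    {i j : ℤ} (i₀ j₀ : ℤ) (hi : i₀ = i - a) (hj : j₀ = j - b) :
    shiftOp A a b f i j = A i₀ j₀ i j (f i₀ j₀) := by
  subst hi hj; rfl

variable (L) in
/-- The operator `(-1)^i` on `∏ L i j`. -/
def signOp : Module.End ℂ (∀ i j, L i j) :=
  LinearMap.pi fun i => zsign i • LinearMap.proj i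

theorem signOp_apply (f : ∀ i j, L i j) (i j : ℤ) : signOp L f i j = zsign i • f i j := rfl

theorem signOp_mul_shiftOp_zero (A : ∀ i j i' j' : ℤ, L i j →ₗ[ℂ] L i' j') (b : ℤ) :
    signOp L * shiftOp A 0 b = shiftOp A 0 b * signOp L := by
  ext f i j
  rw [Module.End.mul_apply, Module.End.mul_apply, signOp_apply,
    shiftOp_apply A _ i (j - b) (by omega) rfl, shiftOp_apply A _ i (j - b) (by omega) rfl,
    signOp_apply, map_zsmul]

theorem shiftOp_one_mul_signOp (A : ∀ i j i' j' : ℤ, L i j →ₗ[ℂ] L i' j') (b : ℤ) :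
    shiftOp A 1 b * signOp L = -(signOp L * shiftOp A 1 b) := by
  ext f i j
  have : zsign i = -zsign (i - 1) := by rw [← zsign_add_one, sub_add_cancel]
  rw [LinearMap.neg_apply, Pi.neg_apply, Pi.neg_apply, Module.End.mul_apply, Module.End.mul_apply,
    signOp_apply, shiftOp_apply A _ (i - 1) (j - b) rfl rfl,
    shiftOp_apply A _ (i - 1) (j - b) rfl rfl, signOp_apply, map_zsmul, this, neg_smul, neg_neg]

theorem signOp_mul_self : signOp L * signOp L = 1 := by
  ext f i j
  rw [Module.End.mul_apply, signOp_apply, signOp_apply, smul_smul, zsign_mul_self, one_smul,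
    Module.End.one_apply]

/-- The element of the Koszul complex formed by the components of `w` in the relevant degrees. -/
def toKT (n d : ℕ) (k m : ℤ) (w : Finset (Fin n) → ∀ i j, L i j) : KT n d L k m :=
  fun S => w S.1 (m - S.1.card) (k + d - S.1.card)

theorem kD_toKT_apply (n d : ℕ) (xA : ∀ (_ : Fin n) (i j i' j' : ℤ), L i j →ₗ[ℂ] L i' j')
    (δ : ∀ (i j i' j' : ℤ), L i j →ₗ[ℂ] L i' j') (k m m' : ℤ) (hm : m' = m + 1)
    (w : Finset (Fin n) → ∀ i j, L i j) (S : Finset (Fin n)) (hS : ∀ l ∈ S, (l : ℕ) < d) :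
    kD n d L xA δ k m m' (toKT n d k m w) ⟨S, hS⟩ =
      δ (m - S.card) (k + d - S.card) (m' - S.card) (k + d - S.card)
        (w S (m - S.card) (k + d - S.card)) +
      zsign (m' - S.card) •
        (∑ l ∈ S.attach,
          zsign ((S.filter (fun x => x < l.1)).card) •
            (xA l.1 (m - ((S.erase l.1).card : ℤ)) (k + d - ((S.erase l.1).card : ℤ))
              (m' - S.card) (k + d - S.card)
              (w (S.erase l.1) (m - ((S.erase l.1).card : ℤ))
                (k + d - ((S.erase l.1).card : ℤ))))) :=
  congrFun (dif_pos hm) _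

/-- The Koszul differential `kD` is the component of `totalD` in the corresponding degrees. -/
theorem kD_toKT (n d : ℕ) (xA : ∀ (_ : Fin n) (i j i' j' : ℤ), L i j →ₗ[ℂ] L i' j')
    (δ : ∀ (i j i' j' : ℤ), L i j →ₗ[ℂ] L i' j') (k m m' : ℤ) (hm : m' = m + 1)
    (w : Finset (Fin n) → ∀ i j, L i j) :
    kD n d L xA δ k m m' (toKT n d k m w) =
      toKT n d k m' (totalD (Finset.univ.filter fun l : Fin n => (l : ℕ) < d)
        (fun l => shiftOp (xA l) 0 (-1)) (shiftOp δ 1 0) (signOp L) w) := by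
  funext ⟨S, hS⟩
  refine (kD_toKT_apply n d xA δ k m m' hm w S hS).trans ?_
  change _ = totalD _ _ _ _ w S (m' - S.card) (k + d - S.card)
  rw [totalD_apply, Pi.add_apply, Pi.add_apply, signOp_apply,
    shiftOp_apply δ _ (m - S.card) (k + d - S.card) (by omega) (by omega)]
  congr 2
  rw [← Finset.sum_filter, Finset.sum_apply, Finset.sum_apply]
  have hfilter : (Finset.univ.filter fun l : Fin n => (l : ℕ) < d).filter (fun l => l ∈ S) = S := by
    ext l
    simpa using hS l
  rw [hfilter, ← Finset.sum_attach S]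
  refine Finset.sum_congr rfl fun l _ => ?_
  have hc := Finset.card_erase_add_one l.2
  rw [Pi.smul_apply, Pi.smul_apply, shiftOp_apply (xA l.1) _ (m - ((S.erase l.1).card : ℤ))
    (k + d - ((S.erase l.1).card : ℤ)) (by omega) (by omega), zsign_natCast, wedgeSign]

end Pieces

/-- **Statement 11.** (Theorem on `b`-functions and Koszul complexes.)
Let `L^•` be a complex of graded `Dₙ`-modules (for level `d`,
`1 ≤ d ≤ n`) with degree-preserving differentials, and let `b ∈ ℂ[s]` be a
polynomial such that `b(θ_d + j)` kills the degree-`j` cohomology of `L^•`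
for all `j`, where `θ_d = x₁∂₁ + … + x_d∂_d`.  Then for every integer `k`
with `b(k) ≠ 0`, the Koszul complex `K^•(L^•, x₁,…,x_d)[k]` is exact. -/
theorem koszul_exact_of_b_function
    (n d : ℕ) (hd1 : 1 ≤ d) (hdn : d ≤ n)
    (L : ℤ → ℤ → Type) [∀ i j, AddCommGroup (L i j)] [∀ i j, Module ℂ (L i j)]
    -- the actions of `x_l` and `∂_l` (`l ≤ d`) on the graded module `L^i`:
    -- `x_l` lowers the degree by 1, `∂_l` raises it by 1 (the maps are
    -- recorded with fully flexible indices and vanish off the correct shape)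
    (xA dA : ∀ (_ : Fin n) (i j i' j' : ℤ), L i j →ₗ[ℂ] L i' j')
    (hxshape : ∀ (l : Fin n) i j i' j', ¬(i' = i ∧ j' = j - 1) → xA l i j i' j' = 0)
    (hdshape : ∀ (l : Fin n) i j i' j', ¬(i' = i ∧ j' = j + 1) → dA l i j i' j' = 0)
    -- the Weyl algebra relations among these operators:
    (hWeyl : ∀ (l : Fin n), (l : ℕ) < d → ∀ i j (u : L i j),
      dA l i (j - 1) i j (xA l i j i (j - 1) u) -
        xA l i (j + 1) i j (dA l i j i (j + 1) u) = u)
    (hxx : ∀ (l m : Fin n), (l : ℕ) < d → (m : ℕ) < d → ∀ i j (u : L i j),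
      xA l i (j - 1) i (j - 1 - 1) (xA m i j i (j - 1) u) =
        xA m i (j - 1) i (j - 1 - 1) (xA l i j i (j - 1) u))
    (hdd : ∀ (l m : Fin n), (l : ℕ) < d → (m : ℕ) < d → ∀ i j (u : L i j),
      dA l i (j + 1) i (j + 1 + 1) (dA m i j i (j + 1) u) =
        dA m i (j + 1) i (j + 1 + 1) (dA l i j i (j + 1) u))
    (hdx : ∀ (l m : Fin n), (l : ℕ) < d → (m : ℕ) < d → l ≠ m → ∀ i j (u : L i j),
      dA l i (j - 1) i j (xA m i j i (j - 1) u) =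
        xA m i (j + 1) i j (dA l i j i (j + 1) u))
    -- the differential `δ` of `L^•`: degree preserving, `Dₙ`-linear, `δ² = 0`
    (δ : ∀ (i j i' j' : ℤ), L i j →ₗ[ℂ] L i' j')
    (hδshape : ∀ i j i' j', ¬(i' = i + 1 ∧ j' = j) → δ i j i' j' = 0)
    (hδx : ∀ (l : Fin n), (l : ℕ) < d → ∀ i j (u : L i j),
      δ i (j - 1) (i + 1) (j - 1) (xA l i j i (j - 1) u) =
        xA l (i + 1) j (i + 1) (j - 1) (δ i j (i + 1) j u))
    (hδd : ∀ (l : Fin n), (l : ℕ) < d → ∀ i j (u : L i j),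
      δ i (j + 1) (i + 1) (j + 1) (dA l i j i (j + 1) u) =
        dA l (i + 1) j (i + 1) (j + 1) (δ i j (i + 1) j u))
    (hδδ : ∀ i j (u : L i j), δ (i + 1) j (i + 2) j (δ i j (i + 1) j u) = 0)
    (b : Polynomial ℂ)
    -- `b(θ_d + j)` kills the cohomology of `L^•` in degree `j`:
    (hb : ∀ i j (u : L i j), δ i j (i + 1) j u = 0 →
      ∃ v : L (i - 1) j, δ (i - 1) j i j v =
        Polynomial.aeval
          ((∑ l : Fin n, if (l : ℕ) < d then
              (xA l i (j + 1) i j).comp (dA l i j i (j + 1)) else 0) +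
            (j : ℂ) • (1 : Module.End ℂ (L i j))) b u)
    (k : ℤ) (hk : Polynomial.eval (k : ℂ) b ≠ 0) :
    ∀ m : ℤ, ∀ u : KT n d L k m,
      kD n d L xA δ k m (m + 1) u = 0 →
        ∃ v : KT n d L k (m - 1), kD n d L xA δ k (m - 1) m v = u := by
  intro m u hu
  set s : Finset (Fin n) := Finset.univ.filter fun l : Fin n => (l : ℕ) < d with hs
  have mem_s : ∀ l, l ∈ s ↔ (l : ℕ) < d := fun l => by simp [hs]
  have hcard : s.card = d := by
    rw [hs, Fin.card_filter_val_lt, min_eq_right hdn]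
  set X : Fin n → Module.End ℂ (∀ i j, L i j) := fun l => shiftOp (xA l) 0 (-1) with hX
  set Y : Fin n → Module.End ℂ (∀ i j, L i j) := fun l => shiftOp (dA l) 0 1 with hY
  have X_apply : ∀ l f i j (j₀ : ℤ), j₀ = j + 1 → X l f i j = xA l i j₀ i j (f i j₀) :=
    fun l f i j j₀ h => shiftOp_apply _ f i j₀ (by omega) (by omega)
  have Y_apply : ∀ l f i j (j₀ : ℤ), j₀ = j - 1 → Y l f i j = dA l i j₀ i j (f i j₀) :=
    fun l f i j j₀ h => shiftOp_apply _ f i j₀ (by omega) (by omega)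
  set Δ : Module.End ℂ (∀ i j, L i j) := shiftOp δ 1 0 with hΔ
  have Δ_apply : ∀ f i j (i₀ : ℤ), i = i₀ + 1 → Δ f i j = δ i₀ j i j (f i₀ j) :=
    fun f i j i₀ h => shiftOp_apply _ f i₀ j (by omega) (by omega)
  have XY_apply : ∀ f i j, (∑ l ∈ s, X l * Y l) f i j =
      (∑ l : Fin n, if (l : ℕ) < d then
        (xA l i (j + 1) i j).comp (dA l i j i (j + 1)) else 0) (f i j) := by
    intro f i j
    rw [hs, Finset.sum_filter, LinearMap.sum_apply, LinearMap.sum_apply, Finset.sum_apply,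
      Finset.sum_apply]
    refine Finset.sum_congr rfl fun l _ => ?_
    split_ifs
    · rw [Module.End.mul_apply, X_apply l _ i j (j + 1) rfl, Y_apply l f i (j + 1) j (by omega)]
      rfl
    · rfl
  let U : Finset (Fin n) → Submodule ℂ (∀ i j, L i j) := fun S =>
    { carrier := {f | ∀ i j, ¬(S ⊆ s ∧ j = k + d - S.card) → f i j = 0}
      zero_mem' := fun _ _ _ => rfl
      add_mem' := fun {f g} hf hg i j h => by
        rw [Pi.add_apply, Pi.add_apply, hf i j h, hg i j h, add_zero]
      smul_mem' := fun a f hf i j h => by rw [Pi.smul_apply, Pi.smul_apply, hf i j h, smul_zero] }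
  have exact_U := totalD_exact s X Y Δ (signOp L)
    (fun l hl l' hl' => by
      ext f i j
      obtain ⟨j, rfl⟩ : ∃ j', j = j' - 1 - 1 := ⟨j + 1 + 1, by omega⟩
      rw [Module.End.mul_apply, Module.End.mul_apply, X_apply l _ _ _ (j - 1) (by omega),
        X_apply l' _ _ _ j (by omega), X_apply l' _ _ _ (j - 1) (by omega),
        X_apply l _ _ _ j (by omega)]
      exact hxx l l' ((mem_s l).1 hl) ((mem_s l').1 hl') i j _)
    (fun l hl => by
      ext f i j
      rw [LinearMap.add_apply, Pi.add_apply, Pi.add_apply, Module.End.mul_apply,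
        Module.End.mul_apply, Module.End.one_apply, Y_apply l _ _ _ (j - 1) rfl,
        X_apply l _ _ _ j (by omega), X_apply l _ _ _ (j + 1) rfl,
        Y_apply l _ _ _ j (by omega)]
      exact sub_eq_iff_eq_add'.1 (hWeyl l ((mem_s l).1 hl) i j _))
    (fun l hl l' hl' hne => by
      ext f i j
      rw [Module.End.mul_apply, Module.End.mul_apply, Y_apply l _ _ _ (j - 1) rfl,
        X_apply l' _ _ _ j (by omega), X_apply l' _ _ _ (j + 1) rfl,
        Y_apply l _ _ _ j (by omega)]
      exact hdx l l' ((mem_s l).1 hl) ((mem_s l').1 hl') hne i j _)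
    (fun l hl => by
      ext f i j
      obtain ⟨j, rfl⟩ : ∃ j', j = j' - 1 := ⟨j + 1, by omega⟩
      obtain ⟨i, rfl⟩ : ∃ i', i = i' + 1 := ⟨i - 1, by omega⟩
      rw [Module.End.mul_apply, Module.End.mul_apply, Δ_apply _ _ _ i rfl,
        X_apply l _ _ _ j (by omega), X_apply l _ _ _ j (by omega), Δ_apply _ _ _ i rfl]
      exact hδx l ((mem_s l).1 hl) i j _)
    (fun l hl => by
      ext f i j
      obtain ⟨j, rfl⟩ : ∃ j', j = j' + 1 := ⟨j - 1, by omega⟩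
      obtain ⟨i, rfl⟩ : ∃ i', i = i' + 1 := ⟨i - 1, by omega⟩
      rw [Module.End.mul_apply, Module.End.mul_apply, Δ_apply _ _ _ i rfl,
        Y_apply l _ _ _ j (by omega), Y_apply l _ _ _ j (by omega), Δ_apply _ _ _ i rfl]
      exact hδd l ((mem_s l).1 hl) i j _)
    (fun l _ => signOp_mul_shiftOp_zero _ _) (fun l _ => signOp_mul_shiftOp_zero _ _)
    (by
      ext f i j
      obtain ⟨i, rfl⟩ : ∃ i', i = i' + 2 := ⟨i - 2, by omega⟩
      rw [Module.End.mul_apply, Δ_apply _ _ _ (i + 1) (by omega), Δ_apply _ _ _ i rfl]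
      exact hδδ i j _)
    (shiftOp_one_mul_signOp _ _) signOp_mul_self b k hk U
    (fun S f hf i j h => by
      rw [Δ_apply f i j (i - 1) (by omega), hf _ _ h, map_zero])
    (fun S f hf i j h => by rw [signOp_apply, hf _ _ h, smul_zero])
    (fun l hl S hlS f hf i j h => by
      rw [X_apply l f i j (j + 1) rfl, hf, map_zero]
      rintro ⟨h1, h2⟩
      have hc := Finset.card_erase_add_one hlS
      refine h ⟨?_, by omega⟩
      rw [← Finset.insert_erase hlS]
      exact Finset.insert_subset hl h1)
    (fun S f hf i j h => by rw [XY_apply, hf _ _ h, map_zero])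
    (fun S hS => by
      rw [Submodule.eq_bot_iff]
      intro f hf
      ext i j
      exact hf i j fun h => hS h.1)
    (fun S f hf hΔf => by
      have hb' : ∀ i j, ∃ v : L i j, (¬(S ⊆ s ∧ j = k + d - S.card) → v = 0) ∧
          δ i j (i + 1) j v = Polynomial.aeval (∑ l ∈ s, X l * Y l +
            (((s \ S).card : ℂ) + k) • (1 : Module.End ℂ (∀ i j, L i j))) b f (i + 1) j := by
        intro i j
        have key : Polynomial.aeval (∑ l ∈ s, X l * Y l +
            (((s \ S).card : ℂ) + k) • (1 : Module.End ℂ (∀ i j, L i j))) b f (i + 1) j =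
            Polynomial.aeval ((∑ l : Fin n, if (l : ℕ) < d then
              (xA l (i + 1) (j + 1) (i + 1) j).comp (dA l (i + 1) j (i + 1) (j + 1)) else 0) +
            (((s \ S).card : ℂ) + k) • (1 : Module.End ℂ (L (i + 1) j))) b (f (i + 1) j) :=
          aeval_intertwine ((LinearMap.proj j).comp (LinearMap.proj (i + 1)) :
            (∀ i j, L i j) →ₗ[ℂ] L (i + 1) j) _ _
          (fun f => congrArg
            (fun x => x + (((s \ S).card : ℂ) + k) • f (i + 1) j) (XY_apply f (i + 1) j)) b f
        rw [key]
        by_cases h : S ⊆ s ∧ j = k + d - S.card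
        · have hbi : ∀ i', i' = i + 1 → ∀ u : L i' j, δ i' j (i' + 1) j u = 0 →
              ∃ v : L i j, δ i j i' j v = Polynomial.aeval
                ((∑ l : Fin n, if (l : ℕ) < d then
                    (xA l i' (j + 1) i' j).comp (dA l i' j i' (j + 1)) else 0) +
                  (j : ℂ) • (1 : Module.End ℂ (L i' j))) b u := by
            intro i' hi'
            obtain rfl : i = i' - 1 := by omega
            exact hb i' j
          obtain ⟨v, hv⟩ := hbi (i + 1) rfl (f (i + 1) j) (by
            rw [← Δ_apply f _ _ (i + 1) rfl, hΔf]; rfl)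
          refine ⟨v, fun h' => absurd h h', ?_⟩
          have hj : ((s \ S).card : ℂ) + k = (j : ℂ) := by
            have h1 := Finset.card_sdiff_add_card_eq_card h.1
            have h2 : j = (s \ S).card + k := by omega
            rw [h2]; push_cast; ring
          rw [hv, hj]
        · exact ⟨0, fun _ => rfl, by rw [hf _ _ h, map_zero, map_zero]⟩
      choose g hg0 hg using hb'
      refine ⟨g, fun i j h => hg0 i j h, ?_⟩
      ext i j
      obtain ⟨i, rfl⟩ : ∃ i', i = i' + 1 := ⟨i - 1, by omega⟩
      rw [Δ_apply g _ _ i rfl, hg])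
  let w : Finset (Fin n) → ∀ i j, L i j := fun S =>
    if h : ∀ l ∈ S, (l : ℕ) < d then
      Pi.single (m - S.card : ℤ) (Pi.single (k + d - S.card : ℤ) (u ⟨S, h⟩)) else 0
  have hw0 : ∀ S i j, ¬(S ⊆ s ∧ i = m - S.card ∧ j = k + d - S.card) → w S i j = 0 := by
    intro S i j h
    simp only [w]
    split_ifs with hS
    · by_cases hi : i = m - S.card
      · subst hi
        rw [Pi.single_eq_same, Pi.single_eq_of_ne]
        exact fun hj => h ⟨fun l hl => (mem_s l).2 (hS l hl), rfl, hj⟩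
      · rw [Pi.single_eq_of_ne hi, Pi.zero_apply]
    · rfl
  have hwu : toKT n d k m w = u := by
    funext ⟨S, hS⟩
    change w S (m - S.card) (k + d - S.card) = u ⟨S, hS⟩
    simp only [w]
    rw [dif_pos hS, Pi.single_eq_same, Pi.single_eq_same]
  obtain ⟨v, hv⟩ := exact_U w (fun S i j h => hw0 S i j fun h' => h ⟨h'.1, h'.2.2⟩) (by
    ext S i j
    by_cases h : S ⊆ s ∧ i = m + 1 - S.card ∧ j = k + d - S.card
    · obtain ⟨hS, rfl, rfl⟩ := h
      have hD := kD_toKT n d xA δ k m (m + 1) rfl w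
      rw [hwu, hu] at hD
      exact (congrFun hD ⟨S, fun l hl => (mem_s l).1 (hS hl)⟩).symm
    · rw [totalD_apply, Pi.add_apply, Pi.add_apply, signOp_apply,
        Δ_apply _ i j (i - 1) (by omega), hw0 S _ _ (fun h' => h ⟨h'.1, by omega, h'.2.2⟩),
        map_zero, zero_add, Finset.sum_apply, Finset.sum_apply, Finset.sum_eq_zero, smul_zero]
      · rfl
      · intro l hl
        split_ifs with hlS
        · rw [Pi.smul_apply, Pi.smul_apply, X_apply l _ i j (j + 1) rfl, hw0, map_zero, smul_zero]
          rintro ⟨h1, h2, h3⟩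
          have hc := Finset.card_erase_add_one hlS
          refine h ⟨?_, by omega, by omega⟩
          rw [← Finset.insert_erase hlS]
          exact Finset.insert_subset hl h1
        · rfl)
  exact ⟨toKT n d k (m - 1) v, by
    rw [kD_toKT n d xA δ k (m - 1) m (by omega) v, ← hwu]
    exact congrArg (toKT n d k m) hv⟩
end
end

section
/- Fix 1 ≤ d ≤ n. Let L^• be a complex of graded D_n-modules (for level d) with degree-preserving differentials δ, and let b ∈ ℂ[s] satisfy b(θ_d + j)·ker(δ : L^i_j → L^{i+1}_j) ⊆ δ(L^{i−1}_j) for all integers i, j. Form the cone K^• = K^•(L^•, x_d), whose piece of degree j in cohomological degree i is K^i_j = L^{i+1}_{j+1} ⊕ L^i_j with differential (u, v) ↦ (−δu, x_d·u + δv). Then b(θ_{d−1} + j)² kills the degree-j cohomology of K^•: for all i, j one has b(θ_{d−1} + j)²·ker(K^i_j → K^{i+1}_j) ⊆ im(K^{i−1}_j → K^i_j), where θ_{d−1} = x₁∂₁ + … + x_{d−1}∂_{d−1}. -/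
set_option synthInstance.maxHeartbeats 1000000
set_option maxHeartbeats 4000000
set_option linter.unusedVariables false

open scoped TensorProduct

noncomputable section

section Cone

variable (n : ℕ) (L : ℤ → ℤ → Type) [∀ i j, AddCommGroup (L i j)] [∀ i j, Module ℂ (L i j)]

/-- The cone `K^• = K^•(L^•, x_d)`: its piece of degree `j` in cohomological
degree `i` is `K^i_j = L^{i+1}_{j+1} ⊕ L^i_j`. -/
def ConeK (i j : ℤ) : Type := L (i + 1) (j + 1) × L i j

instance (i j : ℤ) : AddCommGroup (ConeK L i j) :=
  inferInstanceAs (AddCommGroup (L (i + 1) (j + 1) × L i j))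

variable (xd : ∀ (i j i' j' : ℤ), L i j →ₗ[ℂ] L i' j')
variable (δ : ∀ (i j i' j' : ℤ), L i j →ₗ[ℂ] L i' j')

/-- The differential `(u, v) ↦ (−δu, x_d·u + δv)` of the cone
`K^•(L^•, x_d)` (equal to `0` unless `i' = i + 1` and `j' = j`). -/
def coneD (i j i' j' : ℤ) : ConeK L i j → ConeK L i' j' := fun w =>
  if _h : i' = i + 1 ∧ j' = j then
    (- δ (i + 1) (j + 1) (i' + 1) (j' + 1) w.1,
      xd (i + 1) (j + 1) i' j' w.1 + δ i j i' j' w.2)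
  else 0

end Cone

namespace Polynomial

variable {M N : Type*} [AddCommGroup M] [Module ℂ M] [AddCommGroup N] [Module ℂ N]

/-- A linear map intertwining two endomorphisms intertwines every polynomial in them. -/
theorem map_aeval_apply_of_intertwines (f : M →ₗ[ℂ] N) {A : Module.End ℂ M}
    {A' : Module.End ℂ N} (h : ∀ u, f (A u) = A' (f u)) (b : Polynomial ℂ) (u : M) :
    f (aeval A b u) = aeval A' b (f u) := by
  induction b using Polynomial.induction_on' with
  | add p q hp hq => simp [hp, hq]
  | monomial k c =>
    have key : f ((A ^ k) u) = (A' ^ k) (f u) := by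
      induction k with
      | zero => simp
      | succ k ih => rw [pow_succ', pow_succ', Module.End.mul_apply, h, ih, Module.End.mul_apply]
    simp [aeval_monomial, key]

/-- If `A` and `B` commute, `W` is stable under both and `B u ∈ W`, then
`b(A + B) u ≡ b(A) u` modulo `W`. -/
theorem aeval_add_apply_sub_mem {A B : Module.End ℂ M} (hAB : ∀ u, A (B u) = B (A u))
    {W : Submodule ℂ M} (hA : ∀ u ∈ W, A u ∈ W) (hB : ∀ u ∈ W, B u ∈ W)
    {u : M} (hu : B u ∈ W) (b : Polynomial ℂ) :
    aeval (A + B) b u - aeval A b u ∈ W := by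
  induction b using Polynomial.induction_on' with
  | add p q hp hq =>
    simpa [add_sub_add_comm] using W.add_mem hp hq
  | monomial k c =>
    have hpow : ∀ k : ℕ, B ((A ^ k) u) ∈ W := by
      intro k
      induction k with
      | zero => simpa using hu
      | succ k ih =>
        rw [pow_succ', Module.End.mul_apply, ← hAB]
        exact hA _ ih
    have key : ((A + B) ^ k) u - (A ^ k) u ∈ W := by
      induction k with
      | zero => simp
      | succ k ih =>
        have e : ((A + B) ^ (k + 1)) u - (A ^ (k + 1)) u =
            A (((A + B) ^ k) u - (A ^ k) u) + B (((A + B) ^ k) u - (A ^ k) u) +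
              B ((A ^ k) u) := by
          simp only [pow_succ', Module.End.mul_apply, LinearMap.add_apply, map_sub]
          abel
        rw [e]
        exact W.add_mem (W.add_mem (hA _ ih) (hB _ ih)) (hpow k)
    simpa [aeval_monomial, ← smul_sub] using W.smul_mem c key

end Polynomial

theorem coneD_apply (L : ℤ → ℤ → Type) [∀ i j, AddCommGroup (L i j)] [∀ i j, Module ℂ (L i j)]
    (xd δ : ∀ (i j i' j' : ℤ), L i j →ₗ[ℂ] L i' j') (i j : ℤ) (w : ConeK L i j) :
    coneD L xd δ i j (i + 1) j w =
      (- δ (i + 1) (j + 1) (i + 1 + 1) (j + 1) w.1,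
        xd (i + 1) (j + 1) (i + 1) j w.1 + δ i j (i + 1) j w.2) :=
  dif_pos ⟨rfl, rfl⟩

/-- **Statement 12.** (Inductive step of the `b`-function/Koszul theorem.)
Let `L^•` be a complex of graded `Dₙ`-modules (level `d`, `1 ≤ d ≤ n`) with
degree-preserving differentials `δ`, and let `b ∈ ℂ[s]` satisfy
`b(θ_d + j)·ker(δ : L^i_j → L^{i+1}_j) ⊆ δ(L^{i-1}_j)` for all `i, j`.
Form the cone `K^• = K^•(L^•, x_d)` with `K^i_j = L^{i+1}_{j+1} ⊕ L^i_j` and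
differential `(u,v) ↦ (−δu, x_d·u + δv)`.  Then `b(θ_{d-1} + j)²` kills the
degree-`j` cohomology of `K^•`, where `θ_{d-1} = x₁∂₁ + … + x_{d-1}∂_{d-1}`. -/
theorem cone_b_function_squared
    (n d : ℕ) (hd1 : 1 ≤ d) (hdn : d ≤ n)
    (L : ℤ → ℤ → Type) [∀ i j, AddCommGroup (L i j)] [∀ i j, Module ℂ (L i j)]
    (xA dA : ∀ (_ : Fin n) (i j i' j' : ℤ), L i j →ₗ[ℂ] L i' j')
    (hxshape : ∀ (l : Fin n) i j i' j', ¬(i' = i ∧ j' = j - 1) → xA l i j i' j' = 0)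
    (hdshape : ∀ (l : Fin n) i j i' j', ¬(i' = i ∧ j' = j + 1) → dA l i j i' j' = 0)
    (hWeyl : ∀ (l : Fin n), (l : ℕ) < d → ∀ i j (u : L i j),
      dA l i (j - 1) i j (xA l i j i (j - 1) u) -
        xA l i (j + 1) i j (dA l i j i (j + 1) u) = u)
    (hxx : ∀ (l m : Fin n), (l : ℕ) < d → (m : ℕ) < d → ∀ i j (u : L i j),
      xA l i (j - 1) i (j - 1 - 1) (xA m i j i (j - 1) u) =
        xA m i (j - 1) i (j - 1 - 1) (xA l i j i (j - 1) u))
    (hdd : ∀ (l m : Fin n), (l : ℕ) < d → (m : ℕ) < d → ∀ i j (u : L i j),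
      dA l i (j + 1) i (j + 1 + 1) (dA m i j i (j + 1) u) =
        dA m i (j + 1) i (j + 1 + 1) (dA l i j i (j + 1) u))
    (hdx : ∀ (l m : Fin n), (l : ℕ) < d → (m : ℕ) < d → l ≠ m → ∀ i j (u : L i j),
      dA l i (j - 1) i j (xA m i j i (j - 1) u) =
        xA m i (j + 1) i j (dA l i j i (j + 1) u))
    (δ : ∀ (i j i' j' : ℤ), L i j →ₗ[ℂ] L i' j')
    (hδshape : ∀ i j i' j', ¬(i' = i + 1 ∧ j' = j) → δ i j i' j' = 0)
    (hδx : ∀ (l : Fin n), (l : ℕ) < d → ∀ i j (u : L i j),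
      δ i (j - 1) (i + 1) (j - 1) (xA l i j i (j - 1) u) =
        xA l (i + 1) j (i + 1) (j - 1) (δ i j (i + 1) j u))
    (hδd : ∀ (l : Fin n), (l : ℕ) < d → ∀ i j (u : L i j),
      δ i (j + 1) (i + 1) (j + 1) (dA l i j i (j + 1) u) =
        dA l (i + 1) j (i + 1) (j + 1) (δ i j (i + 1) j u))
    (hδδ : ∀ i j (u : L i j), δ (i + 1) j (i + 2) j (δ i j (i + 1) j u) = 0)
    (b : Polynomial ℂ)
    -- `b(θ_d + j)` kills the cohomology of `L^•` in degree `j`: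
    (hb : ∀ i j (u : L i j), δ i j (i + 1) j u = 0 →
      ∃ v : L (i - 1) j, δ (i - 1) j i j v =
        Polynomial.aeval
          ((∑ l : Fin n, if (l : ℕ) < d then
              (xA l i (j + 1) i j).comp (dA l i j i (j + 1)) else 0) +
            (j : ℂ) • (1 : Module.End ℂ (L i j))) b u) :
    -- then `b(θ_{d-1} + j)²` kills the degree-`j` cohomology of the cone:
    ∀ i j : ℤ, ∀ w : ConeK L i j,
      coneD L (xA ⟨d - 1, by omega⟩) δ i j (i + 1) j w = 0 →
        ∃ w' : ConeK L (i - 1) j,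
          coneD L (xA ⟨d - 1, by omega⟩) δ (i - 1) j i j w' =
            ((Polynomial.aeval
                ((∑ l : Fin n, if (l : ℕ) < d - 1 then
                    (xA l (i + 1) (j + 1 + 1) (i + 1) (j + 1)).comp
                      (dA l (i + 1) (j + 1) (i + 1) (j + 1 + 1)) else 0) +
                  (j : ℂ) • (1 : Module.End ℂ (L (i + 1) (j + 1)))) (b * b)) w.1,
             (Polynomial.aeval
                ((∑ l : Fin n, if (l : ℕ) < d - 1 then
                    (xA l i (j + 1) i j).comp (dA l i j i (j + 1)) else 0) +
                  (j : ℂ) • (1 : Module.End ℂ (L i j))) (b * b)) w.2) := by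
  intro i j w hw
  obtain ⟨e, he⟩ : ∃ e : Fin n, e = ⟨d - 1, by omega⟩ := ⟨_, rfl⟩
  rw [← he] at hw ⊢
  have hed : (e : ℕ) < d := by rw [he]; simp only; omega
  have weyl (i j k m : ℤ) (hk : k = j - 1) (hm : m = j + 1) (u : L i j) :
      dA e i k i j (xA e i j i k u) = xA e i m i j (dA e i j i m u) + u := by
    subst hk hm
    exact sub_eq_iff_eq_add'.mp (hWeyl e hed i j u)
  have xx (l : Fin n) (hl : (l : ℕ) < d) (i j k m : ℤ) (hk : k = j - 1) (hm : m = k - 1)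
      (u : L i j) :
      xA l i k i m (xA e i j i k u) = xA e i k i m (xA l i j i k u) := by
    subst hk hm
    exact hxx l e hl hed i j u
  have dx (l m : Fin n) (hl : (l : ℕ) < d) (hm : (m : ℕ) < d) (hlm : l ≠ m)
      (i j k k' : ℤ) (hk : k = j - 1) (hk' : k' = j + 1) (u : L i j) :
      dA l i k i j (xA m i j i k u) = xA m i k' i j (dA l i j i k' u) := by
    subst hk hk'
    exact hdx l m hl hm hlm i j u
  have δx (i j k : ℤ) (hk : k = j - 1) (l : Fin n) (hl : (l : ℕ) < d) (u : L i j) :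
      δ i k (i + 1) k (xA l i j i k u) = xA l (i + 1) j (i + 1) k (δ i j (i + 1) j u) := by
    subst hk
    exact hδx l hl i j u
  -- `T` is the action of `θ_{d-1}`.
  obtain ⟨T, hT⟩ : ∃ T : ∀ i j, Module.End ℂ (L i j), ∀ i j, T i j =
      ∑ l : Fin n, if (l : ℕ) < d - 1 then
        (xA l i (j + 1) i j).comp (dA l i j i (j + 1)) else 0 := ⟨_, fun _ _ => rfl⟩
  have hTapp (i j : ℤ) (u : L i j) : T i j u = ∑ l : Fin n, if (l : ℕ) < d - 1 then
      xA l i (j + 1) i j (dA l i j i (j + 1) u) else 0 := by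
    rw [hT, LinearMap.sum_apply]
    refine Finset.sum_congr rfl fun l _ => ?_
    split_ifs <;> rfl
  have hfull (i j : ℤ) : (∑ l : Fin n, if (l : ℕ) < d then
      (xA l i (j + 1) i j).comp (dA l i j i (j + 1)) else 0) =
        T i j + (xA e i (j + 1) i j).comp (dA e i j i (j + 1)) := by
    have hsplit (l : Fin n) : (if (l : ℕ) < d then
        (xA l i (j + 1) i j).comp (dA l i j i (j + 1)) else 0) =
        (if (l : ℕ) < d - 1 then (xA l i (j + 1) i j).comp (dA l i j i (j + 1)) else 0) +
        (if l = e then (xA l i (j + 1) i j).comp (dA l i j i (j + 1)) else 0) := by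
      have hle : l = e ↔ (l : ℕ) = d - 1 := by rw [he, Fin.ext_iff]
      simp only [hle]
      split_ifs <;> first | omega | simp
    rw [Finset.sum_congr rfl fun l _ => hsplit l, Finset.sum_add_distrib, ← hT]
    simp
  have hne (l : Fin n) (hl : (l : ℕ) < d - 1) : l ≠ e := by
    rintro rfl
    simp [he] at hl
  have Tx (i j : ℤ) (u : L i (j + 1)) :
      xA e i (j + 1) i j (T i (j + 1) u) = T i j (xA e i (j + 1) i j u) := by
    rw [hTapp, hTapp, map_sum]
    refine Finset.sum_congr rfl fun l _ => ?_
    split_ifs with hl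
    · rw [dx l e (by omega) hed (hne l hl) i (j + 1) j (j + 1 + 1) (by omega) rfl,
        xx l (by omega) i (j + 1 + 1) (j + 1) j (by omega) (by omega)]
    · simp
  have Td (i j : ℤ) (u : L i j) :
      dA e i j i (j + 1) (T i j u) = T i (j + 1) (dA e i j i (j + 1) u) := by
    rw [hTapp, hTapp, map_sum]
    refine Finset.sum_congr rfl fun l _ => ?_
    split_ifs with hl
    · rw [hdd l e (by omega) hed i j u,
        dx e l hed (by omega) (hne l hl).symm i (j + 1) j (j + 1 + 1) (by omega) rfl]
    · simp
  have Tδ (i j : ℤ) (u : L i j) :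
      δ i j (i + 1) j (T i j u) = T (i + 1) j (δ i j (i + 1) j u) := by
    rw [hTapp, hTapp, map_sum]
    refine Finset.sum_congr rfl fun l _ => ?_
    split_ifs with hl
    · rw [δx i (j + 1) j (by omega) l (by omega), hδd l (by omega)]
    · simp
  have hb' (p j : ℤ) (u : L (p + 1) j) (hu : δ (p + 1) j (p + 1 + 1) j u = 0) :
      ∃ v : L p j, δ p j (p + 1) j v = Polynomial.aeval
        (T (p + 1) j + (xA e (p + 1) (j + 1) (p + 1) j).comp
          (dA e (p + 1) j (p + 1) (j + 1)) + (j : ℂ) • (1 : Module.End ℂ (L (p + 1) j))) b u := by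
    have h := hb (p + 1) j u hu
    rw [hfull] at h
    rwa [add_sub_cancel_right] at h
  rw [← hT, ← hT]
  obtain ⟨p, hp⟩ : ∃ p : ℤ, p = i - 1 := ⟨_, rfl⟩
  rw [← hp]
  obtain rfl : i = p + 1 := by omega
  obtain ⟨u, v⟩ := w
  obtain ⟨S, hS⟩ : ∃ S : ∀ i m, Module.End ℂ (L i m), ∀ i m, S i m =
      T i m + (j : ℂ) • (1 : Module.End ℂ (L i m)) := ⟨_, fun _ _ => rfl⟩
  have hSapp (i m : ℤ) (u : L i m) : S i m u = T i m u + (j : ℂ) • u := by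
    rw [hS]; rfl
  have Sx (i m : ℤ) (u : L i (m + 1)) :
      xA e i (m + 1) i m (S i (m + 1) u) = S i m (xA e i (m + 1) i m u) := by
    simp [hSapp, Tx]
  have Sd (i m : ℤ) (u : L i m) :
      dA e i m i (m + 1) (S i m u) = S i (m + 1) (dA e i m i (m + 1) u) := by
    simp [hSapp, Td]
  have Sδ (i m : ℤ) (u : L i m) :
      δ i m (i + 1) m (S i m u) = S (i + 1) m (δ i m (i + 1) m u) := by
    simp [hSapp, Tδ]
  simp only [← hS]
  have hw' : δ (p + 1 + 1) (j + 1) (p + 1 + 1 + 1) (j + 1) u = 0 ∧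
      xA e (p + 1 + 1) (j + 1) (p + 1 + 1) j u + δ (p + 1) j (p + 1 + 1) j v = 0 := by
    obtain ⟨h1, h2⟩ := Prod.mk.inj ((coneD_apply L (xA e) δ (p + 1) j (u, v)).symm.trans hw)
    exact ⟨neg_eq_zero.mp h1, h2⟩
  obtain ⟨hu, huv⟩ := hw'
  -- `b(θ_{d-1} + j) u` is a boundary.
  obtain ⟨U, hU⟩ : ∃ U : L (p + 1) (j + 1), δ (p + 1) (j + 1) (p + 1 + 1) (j + 1) U =
      Polynomial.aeval (S (p + 1 + 1) (j + 1)) b u := by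
    obtain ⟨u', hu'⟩ := hb' (p + 1) (j + 1) u hu
    have hop : T (p + 1 + 1) (j + 1) + (xA e (p + 1 + 1) (j + 1 + 1) (p + 1 + 1) (j + 1)).comp
          (dA e (p + 1 + 1) (j + 1) (p + 1 + 1) (j + 1 + 1)) +
          ((j + 1 : ℤ) : ℂ) • (1 : Module.End ℂ (L (p + 1 + 1) (j + 1))) =
        S (p + 1 + 1) (j + 1) + (dA e (p + 1 + 1) j (p + 1 + 1) (j + 1)).comp
          (xA e (p + 1 + 1) (j + 1) (p + 1 + 1) j) := by
      ext y
      simp only [LinearMap.add_apply, LinearMap.comp_apply, LinearMap.smul_apply,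
        Module.End.one_apply, hSapp]
      rw [weyl (p + 1 + 1) (j + 1) j (j + 1 + 1) (by omega) rfl]
      push_cast
      rw [add_smul, one_smul]
      abel
    rw [hop] at hu'
    have hmem := Polynomial.aeval_add_apply_sub_mem (A := S (p + 1 + 1) (j + 1))
      (B := (dA e (p + 1 + 1) j (p + 1 + 1) (j + 1)).comp
        (xA e (p + 1 + 1) (j + 1) (p + 1 + 1) j))
      (W := LinearMap.range (δ (p + 1) (j + 1) (p + 1 + 1) (j + 1))) (u := u)
      (fun y => by rw [LinearMap.comp_apply, LinearMap.comp_apply, Sx, Sd])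
      (by
        rintro _ ⟨y, rfl⟩
        exact ⟨S _ _ y, Sδ _ _ y⟩)
      (by
        rintro _ ⟨y, rfl⟩
        refine ⟨dA e (p + 1) j (p + 1) (j + 1) (xA e (p + 1) (j + 1) (p + 1) j y), ?_⟩
        rw [LinearMap.comp_apply, hδd e hed, δx _ _ _ (by omega) e hed])
      (by
        refine ⟨- dA e (p + 1) j (p + 1) (j + 1) v, ?_⟩
        rw [LinearMap.comp_apply, eq_neg_of_add_eq_zero_left huv, map_neg, map_neg, hδd e hed])
      b
    obtain ⟨y, hy⟩ := hmem
    refine ⟨u' - y, ?_⟩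
    rw [map_sub, hy, hu']
    abel
  -- `(0, v')` is cohomologous to `b(θ_{d-1} + j) (u, v)`.
  obtain ⟨v', hv'⟩ : ∃ v' : L (p + 1) j, v' = Polynomial.aeval (S (p + 1) j) b v +
      xA e (p + 1) (j + 1) (p + 1) j U := ⟨_, rfl⟩
  have hδv' : δ (p + 1) j (p + 1 + 1) j v' = 0 := by
    rw [hv', map_add, Polynomial.map_aeval_apply_of_intertwines _ (Sδ (p + 1) j),
      δx _ _ _ (by omega) e hed, hU, Polynomial.map_aeval_apply_of_intertwines _ (Sx (p + 1 + 1) j),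
      ← map_add, add_comm (δ (p + 1) j (p + 1 + 1) j v), huv, map_zero]
  obtain ⟨y, z, hy, hyz⟩ : ∃ (y : L (p + 1) j) (z : L p j), δ (p + 1) j (p + 1 + 1) j y = 0 ∧
      xA e (p + 1) (j + 1) (p + 1) j (dA e (p + 1) j (p + 1) (j + 1) y) + δ p j (p + 1) j z =
        Polynomial.aeval (S (p + 1) j) b v' := by
    obtain ⟨z, hz⟩ := hb' p j v' hδv'
    rw [add_right_comm, ← hS] at hz
    have hmem := Polynomial.aeval_add_apply_sub_mem (A := S (p + 1) j)
      (B := (xA e (p + 1) (j + 1) (p + 1) j).comp (dA e (p + 1) j (p + 1) (j + 1)))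
      (W := (LinearMap.ker (δ (p + 1) j (p + 1 + 1) j)).map
        ((xA e (p + 1) (j + 1) (p + 1) j).comp (dA e (p + 1) j (p + 1) (j + 1)))) (u := v')
      (fun y => by rw [LinearMap.comp_apply, LinearMap.comp_apply, Sd, Sx])
      (by
        rintro _ ⟨y, hy, rfl⟩
        refine ⟨S _ _ y, ?_, ?_⟩
        · have hy' : δ (p + 1) j (p + 1 + 1) j y = 0 := hy
          change δ (p + 1) j (p + 1 + 1) j _ = 0
          rw [Sδ, hy', map_zero]
        · rw [LinearMap.comp_apply, LinearMap.comp_apply, Sd, Sx])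
      (by
        rintro _ ⟨y, hy, rfl⟩
        refine ⟨_, ?_, rfl⟩
        have hy' : δ (p + 1) j (p + 1 + 1) j y = 0 := hy
        change δ (p + 1) j (p + 1 + 1) j _ = 0
        rw [LinearMap.comp_apply, δx _ _ _ (by omega) e hed, hδd e hed, hy', map_zero, map_zero])
      ⟨v', hδv', rfl⟩ b
    obtain ⟨y, hy, hyz⟩ := hmem
    refine ⟨-y, z, ?_, ?_⟩
    · rw [map_neg, neg_eq_zero]
      exact hy
    · rw [LinearMap.comp_apply] at hyz
      rw [map_neg, map_neg, hyz, hz]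
      abel
  refine ⟨(dA e (p + 1) j (p + 1) (j + 1) y - Polynomial.aeval (S (p + 1) (j + 1)) b U, z), ?_⟩
  refine (coneD_apply L (xA e) δ p j _).trans ?_
  simp only [map_mul, Module.End.mul_apply]
  refine Prod.ext ?_ ?_
  · change - δ (p + 1) (j + 1) (p + 1 + 1) (j + 1) _ = Polynomial.aeval (S (p + 1 + 1) (j + 1)) b _
    rw [map_sub, hδd e hed, hy, map_zero, zero_sub, neg_neg,
      Polynomial.map_aeval_apply_of_intertwines _ (Sδ (p + 1) (j + 1)), hU]
  · change xA e (p + 1) (j + 1) (p + 1) j _ + δ p j (p + 1) j z =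
      Polynomial.aeval (S (p + 1) j) b _
    rw [map_sub, Polynomial.map_aeval_apply_of_intertwines _ (Sx (p + 1) j), sub_add_eq_add_sub,
      hyz, hv', map_add, add_sub_cancel_right]
end
end
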